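/- arXiv:math/9806166 — 3 statements merged into one kernel-verified Lean document; each statement's English description precedes it below -/
import Mathlib

section
/- Let M be a transitive model of ZFC and let U be a perfect nowhere dense tree on {0,1} that 𝕌𝕄-dominates M. If D ⊆ 𝕌𝕄 ∩ M is a dense subset of the universal meager forcing as computed in M, with D ∈ M, then D ∩ 𝕌𝕄(U) is dense in 𝕌𝕄(U) ∩ M. -/
noncomputable section

open ZFSet

/-! ### Internal first-order language of set theory and satisfaction in a set `M` -/

/-- First-order formulas of set theory, with de Bruijn variables. -/
inductive Fml : ℕ → Type
  | mem {n} (i j : Fin n) : Fml n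
  | eq {n} (i j : Fin n) : Fml n
  | imp {n} : Fml n → Fml n → Fml n
  | neg {n} : Fml n → Fml n
  | all {n} : Fml (n + 1) → Fml n

namespace Fml

def and {n} (φ ψ : Fml n) : Fml n := neg (imp φ (neg ψ))
def or {n} (φ ψ : Fml n) : Fml n := imp (neg φ) ψ
def iff {n} (φ ψ : Fml n) : Fml n := (imp φ ψ).and (imp ψ φ)
def ex {n} (φ : Fml (n + 1)) : Fml n := neg (all (neg φ))

/-- Variable renaming. -/
def rename : ∀ {m k : ℕ}, (Fin m → Fin k) → Fml m → Fml k
  | _, _, r, mem i j => mem (r i) (r j)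
  | _, _, r, eq i j => eq (r i) (r j)
  | _, _, r, imp φ ψ => imp (rename r φ) (rename r ψ)
  | _, _, r, neg φ => neg (rename r φ)
  | _, _, r, all φ => all (rename (fun i => Fin.cases 0 (fun j => (r j).succ) i) φ)

end Fml

/-- Satisfaction of a formula in the structure `(M, ∈)`, with valuation `v`. -/
def SatM (M : ZFSet) : ∀ {n : ℕ}, Fml n → (Fin n → ZFSet) → Prop
  | _, .mem i j, v => v i ∈ v j
  | _, .eq i j, v => v i = v j
  | _, .imp φ ψ, v => SatM M φ v → SatM M ψ v
  | _, .neg φ, v => ¬ SatM M φ v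
  | _, .all φ, v => ∀ x : ZFSet, x ∈ M → SatM M φ (Fin.cons x v)

/-- Satisfaction for all valuations into `M`. -/
def SatAll (M : ZFSet) {n : ℕ} (φ : Fml n) : Prop :=
  ∀ v : Fin n → ZFSet, (∀ i, v i ∈ M) → SatM M φ v

/-! The axioms of ZFC. -/

def axExt : Fml 2 := .imp (.all (.iff (.mem 0 1) (.mem 0 2))) (.eq 0 1)
def axPair : Fml 2 := .ex (.and (.mem 1 0) (.mem 2 0))
def axUnion : Fml 1 := .ex (.all (.all (.imp (.and (.mem 0 1) (.mem 1 3)) (.mem 0 2))))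
def axPower : Fml 1 := .ex (.all (.imp (.all (.imp (.mem 0 1) (.mem 0 3))) (.mem 0 1)))
def axInf : Fml 0 :=
  .ex (.and (.ex (.and (.mem 0 1) (.all (.neg (.mem 0 1)))))
    (.all (.imp (.mem 0 1)
      (.ex (.and (.mem 0 2) (.and (.mem 1 0)
        (.all (.iff (.mem 0 1) (.or (.mem 0 2) (.eq 0 2))))))))))
def axFound : Fml 1 :=
  .imp (.ex (.mem 0 1)) (.ex (.and (.mem 0 1) (.all (.imp (.mem 0 1) (.neg (.mem 0 2))))))
def axChoice : Fml 1 :=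
  .imp
    (.and (.all (.imp (.mem 0 1) (.ex (.mem 0 1))))
      (.all (.imp (.mem 0 1) (.all (.imp (.mem 0 2)
        (.imp (.neg (.eq 1 0)) (.neg (.ex (.and (.mem 0 2) (.mem 0 1))))))))))
    (.ex (.all (.imp (.mem 0 2) (.ex (.and (.mem 0 1) (.and (.mem 0 2)
      (.all (.imp (.and (.mem 0 2) (.mem 0 3)) (.eq 0 1)))))))))

/-- Separation axiom for the formula `φ(x, p₁, …, pₙ)`. -/
def axSep {n : ℕ} (φ : Fml (n + 1)) : Fml (n + 1) :=
  .ex (.all (.iff (.mem 0 1) (.and (.mem 0 2)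
    (φ.rename (fun i => Fin.cases 0 (fun j => j.succ.succ.succ) i)))))

/-- Collection axiom for the formula `φ(x, y, p₁, …, pₙ)`. -/
def axColl {n : ℕ} (φ : Fml (n + 2)) : Fml (n + 1) :=
  .imp
    (.all (.imp (.mem 0 1)
      (.ex (φ.rename (fun i =>
        Fin.cases 1 (fun i' => Fin.cases 0 (fun j => j.succ.succ.succ) i') i)))))
    (.ex (.all (.imp (.mem 0 2) (.ex (.and (.mem 0 2)
      (φ.rename (fun i =>
        Fin.cases 1 (fun i' => Fin.cases 0 (fun j => j.succ.succ.succ.succ) i') i)))))))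

/-- `M` is a transitive model of ZFC (with the collection scheme). -/
def IsTransModelZFC (M : ZFSet) : Prop :=
  M.IsTransitive ∧ SatAll M axExt ∧ SatAll M axPair ∧ SatAll M axUnion ∧
    SatAll M axPower ∧ SatAll M axInf ∧ SatAll M axFound ∧ SatAll M axChoice ∧
    (∀ (n : ℕ) (φ : Fml (n + 1)), SatAll M (axSep φ)) ∧
    (∀ (n : ℕ) (φ : Fml (n + 2)), SatAll M (axColl φ))

/-! ### Coding countable objects as elements of `ZFSet` -/

/-- The von Neumann natural numbers. -/
def natZF : ℕ → ZFSet
  | 0 => ∅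
  | n + 1 => insert (natZF n) (natZF n)

/-- The code of a function `ℕ → ℕ` as a set of Kuratowski pairs. -/
def funZF (f : ℕ → ℕ) : ZFSet :=
  ZFSet.range fun n : ℕ => ZFSet.pair (natZF n) (natZF (f n))

/-- The code of a finite sequence of naturals. -/
def listZF (l : List ℕ) : ZFSet :=
  ZFSet.range fun i : Fin l.length => ZFSet.pair (natZF i) (natZF (l.get i))

/-- The code of a set of finite sequences of naturals. -/
def listSetZF (D : Set (List ℕ)) : ZFSet :=
  ZFSet.range fun l : D => listZF l.1

end

noncomputable section

/-! ### The universal meager forcing -/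

/-- A (prefix-closed) tree on `{0,1}`. -/
def IsTree (T : Set (List Bool)) : Prop := ∀ s ∈ T, ∀ t : List Bool, t <+: s → t ∈ T

/-- A perfect tree: nonempty and every node has two incomparable extensions in the tree. -/
def PerfectTree (T : Set (List Bool)) : Prop :=
  T.Nonempty ∧ IsTree T ∧
    ∀ s ∈ T, ∃ t₁ ∈ T, ∃ t₂ ∈ T, s <+: t₁ ∧ s <+: t₂ ∧ ¬ t₁ <+: t₂ ∧ ¬ t₂ <+: t₁

/-- A nowhere dense tree: every finite sequence has an extension outside the tree. -/
def NwdTree (T : Set (List Bool)) : Prop := ∀ s : List Bool, ∃ t, s <+: t ∧ t ∉ T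

/-- `T ∈ NWD`: a perfect nowhere dense tree on `{0,1}`. -/
def NWD (T : Set (List Bool)) : Prop := PerfectTree T ∧ NwdTree T

/-- `T↾x`: the elements of `T` comparable with some element of `x`. -/
def treeRestrict (T x : Set (List Bool)) : Set (List Bool) :=
  {t ∈ T | ∃ s ∈ x, s <+: t ∨ t <+: s}

/-- `A ∩ B ∩ 2^n`. -/
def levelSet (A B : Set (List Bool)) (n : ℕ) : Set (List Bool) :=
  {l | l ∈ A ∧ l ∈ B ∧ l.length = n}

/-- Conditions of the universal meager forcing `𝕌𝕄`: pairs `⟨n, S⟩` with `S ∈ NWD`. -/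
abbrev UMCond := ℕ × Set (List Bool)

/-- The order of `𝕌𝕄`: `⟨n,S⟩ ≤ ⟨m,T⟩` iff `n ≥ m`, `T ⊆ S` and `S ∩ 2^m = T ∩ 2^m`. -/
def umLe (q p : UMCond) : Prop :=
  p.1 ≤ q.1 ∧ p.2 ⊆ q.2 ∧ ∀ l : List Bool, l.length = p.1 → (l ∈ q.2 ↔ l ∈ p.2)

/-- The code of a finite binary sequence. -/
def listBoolZF (l : List Bool) : ZFSet :=
  ZFSet.range fun i : Fin l.length =>
    ZFSet.pair (natZF i) (natZF (if l.get i then 1 else 0))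

/-- The code of a set of finite binary sequences (e.g. a tree on `{0,1}`). -/
def treeZF (T : Set (List Bool)) : ZFSet := ZFSet.range fun t : T => listBoolZF t.1

/-- The code of a `𝕌𝕄`-condition. -/
def umCondZF (p : UMCond) : ZFSet := ZFSet.pair (natZF p.1) (treeZF p.2)

/-- The code of a set of `𝕌𝕄`-conditions. -/
def umSetZF (D : Set UMCond) : ZFSet := ZFSet.range fun q : D => umCondZF q.1

/-- `U` `𝕌𝕄`-dominates the transitive model `M`: some `NWD` tree of `M` is included in
`U`, and for every `NWD` tree `T ∈ M` there is `n` such that, with `x = T ∩ U ∩ 2^n`,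
`T↾x ⊆ U↾x`. -/
def UMDominates (M : ZFSet) (U : Set (List Bool)) : Prop :=
  (∃ T : Set (List Bool), treeZF T ∈ M ∧ NWD T ∧ T ⊆ U) ∧
    ∀ T : Set (List Bool), treeZF T ∈ M → NWD T →
      ∃ n : ℕ, treeRestrict T (levelSet T U n) ⊆ treeRestrict U (levelSet T U n)

/-! ### Combinatorics of trees -/

def agr (T Q : Set (List Bool)) (n : ℕ) : Prop := ∀ s ∈ Q, s ∈ T ∨ n < s.length

theorem nwd_finite_sUnion (F : Set (Set (List Bool))) (hF : F.Finite)
    (h : ∀ Q ∈ F, NwdTree Q ∧ IsTree Q) : NwdTree (⋃₀ F) := by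
  induction F, hF using Set.Finite.induction_on with
  | empty => intro s; exact ⟨s, List.prefix_rfl, by simp⟩
  | @insert a F _ _ ih =>
    intro s
    obtain ⟨t, hst, ht⟩ := ih (fun Q hQ => h Q (Set.mem_insert_of_mem _ hQ)) s
    obtain ⟨u, htu, hu⟩ := (h a (Set.mem_insert _ _)).1 t
    refine ⟨u, hst.trans htu, ?_⟩
    rintro ⟨Q, hQ, huQ⟩
    rcases hQ with rfl | hQ
    · exact hu huQ
    · exact ht ⟨Q, hQ, (h Q (Set.mem_insert_of_mem _ hQ)).2 u huQ t htu⟩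

theorem nwd_sUnion (T : Set (List Bool)) (hT : NwdTree T) (C : Set (Set (List Bool)))
    (h : ∀ Q ∈ C, NwdTree Q ∧ IsTree Q)
    (inj : ∀ Q ∈ C, ∀ Q' ∈ C, (∀ n, agr T Q n ↔ agr T Q' n) → Q = Q') :
    NwdTree (⋃₀ C) := by
  intro s
  obtain ⟨t, hst, ht⟩ := hT s
  have key : ∀ Q, t ∈ Q → ∀ n, t.length ≤ n → ¬ agr T Q n := by
    intro Q hQ n hn hag
    rcases hag t hQ with h1 | h1
    · exact ht h1
    · omega
  have hfin : {Q ∈ C | t ∈ Q}.Finite := by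
    refine Set.Finite.of_injOn (f := fun Q => {k | k < t.length ∧ agr T Q k})
      (t := 𝒫 (Set.Iio t.length)) ?_ ?_ (Set.finite_Iio _).powerset
    · intro Q _ k hk
      exact hk.1
    · intro Q hQ Q' hQ' heq
      refine inj Q hQ.1 Q' hQ'.1 fun n => ?_
      by_cases hn : n < t.length
      · have := Set.ext_iff.1 heq n
        simpa [hn] using this
      · exact iff_of_false (key Q hQ.2 n (by omega)) (key Q' hQ'.2 n (by omega))
  obtain ⟨u, htu, hu⟩ := nwd_finite_sUnion _ hfin (fun Q hQ => h Q hQ.1) t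
  refine ⟨u, hst.trans htu, ?_⟩
  rintro ⟨Q, hQ, huQ⟩
  exact hu ⟨Q, ⟨hQ, (h Q hQ).2 u huQ t htu⟩, huQ⟩

theorem perfect_sUnion (C : Set (Set (List Bool))) (hne : C.Nonempty)
    (h : ∀ Q ∈ C, PerfectTree Q) : PerfectTree (⋃₀ C) := by
  refine ⟨?_, ?_, ?_⟩
  · obtain ⟨Q, hQ⟩ := hne
    obtain ⟨s, hs⟩ := (h Q hQ).1
    exact ⟨s, Q, hQ, hs⟩
  · rintro s ⟨Q, hQ, hs⟩ t hts
    exact ⟨Q, hQ, (h Q hQ).2.1 s hs t hts⟩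
  · rintro s ⟨Q, hQ, hs⟩
    obtain ⟨t₁, h1, t₂, h2, h3⟩ := (h Q hQ).2.2 s hs
    exact ⟨t₁, ⟨Q, hQ, h1⟩, t₂, ⟨Q, hQ, h2⟩, h3⟩

theorem perfect_extend {Q : Set (List Bool)} (hQ : PerfectTree Q) {s : List Bool} (hs : s ∈ Q)
    (n : ℕ) (hn : s.length ≤ n) : ∃ t ∈ Q, s <+: t ∧ t.length = n := by
  induction n, hn using Nat.le_induction with
  | base => exact ⟨s, hs, List.prefix_rfl, rfl⟩
  | succ n _ ih =>
    obtain ⟨t, ht, hst, htn⟩ := ih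
    obtain ⟨t₁, h1, t₂, h2, h3, h4, h5, h6⟩ := hQ.2.2 t ht
    have hlt : n + 1 ≤ t₁.length := by
      by_contra hcon
      have := h3.length_le
      have heq : t = t₁ := h3.eq_of_length (by omega)
      exact h5 (heq ▸ h4)
    have hp : t <+: t₁.take (n + 1) := by
      rw [List.prefix_take_iff]
      exact ⟨h3, by omega⟩
    exact ⟨t₁.take (n + 1), hQ.2.1 _ h1 _ (List.take_prefix _ _), hst.trans hp,
      by simp [hlt]⟩

theorem agr_of_level {T Q : Set (List Bool)} (hT : IsTree T) (hQ : PerfectTree Q) {n : ℕ}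
    (h : ∀ l : List Bool, l.length = n → (l ∈ Q ↔ l ∈ T)) : agr T Q n := by
  intro s hs
  by_cases hn : n < s.length
  · exact Or.inr hn
  · obtain ⟨t, ht, hst, htn⟩ := perfect_extend hQ hs n (by omega)
    exact Or.inl (hT t ((h t htn).1 ht) s hst)

/-- The capturing argument. -/
theorem captured {T Q S U : Set (List Bool)} {n m : ℕ} (hQ : PerfectTree Q) (hT : IsTree T)
    (hTQ : T ⊆ Q) (hQS : Q ⊆ S) (hTU : T ⊆ U) (hnm : n ≤ m) (ha : agr T Q m)
    (hn : treeRestrict S (levelSet S U n) ⊆ treeRestrict U (levelSet S U n)) : Q ⊆ U := by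
  intro s hs
  have : ∃ t ∈ Q, s <+: t ∧ n ≤ t.length := by
    by_cases h : s.length ≤ n
    · obtain ⟨t, ht, h1, h2⟩ := perfect_extend hQ hs n h
      exact ⟨t, ht, h1, h2.ge⟩
    · exact ⟨s, hs, List.prefix_rfl, by omega⟩
  obtain ⟨t, ht, hst, htn⟩ := this
  have hr : t.take n ∈ Q := hQ.2.1 t ht _ (List.take_prefix _ _)
  have hrT : t.take n ∈ T := by
    rcases ha _ hr with h | h
    · exact h
    · simp at h
      omega
  refine (hn ⟨hQS hs, t.take n, ⟨hQS hr, hTU hrT, by simp [htn]⟩, ?_⟩).1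
  exact List.prefix_or_prefix_of_prefix (List.take_prefix _ _) hst

/-! ### Codes -/

theorem mem_natZF (x : ZFSet) (k : ℕ) : x ∈ natZF k ↔ ∃ i < k, x = natZF i := by
  induction k with
  | zero => simp [natZF]
  | succ k ih =>
    rw [natZF, ZFSet.mem_insert_iff, ih]
    constructor
    · rintro (h | ⟨i, hi, h⟩)
      · exact ⟨k, by omega, h⟩
      · exact ⟨i, by omega, h⟩
    · rintro ⟨i, hi, h⟩
      rcases Nat.lt_succ_iff_lt_or_eq.1 hi with h1 | rfl
      · exact Or.inr ⟨i, h1, h⟩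
      · exact Or.inl h

theorem natZF_inj {i j : ℕ} (h : natZF i = natZF j) : i = j := by
  rcases lt_trichotomy i j with h1 | h1 | h1
  · have : natZF i ∈ natZF j := (mem_natZF _ _).2 ⟨i, h1, rfl⟩
    rw [h] at this
    exact absurd this (ZFSet.mem_irrefl _)
  · exact h1
  · have : natZF j ∈ natZF i := (mem_natZF _ _).2 ⟨j, h1, rfl⟩
    rw [h] at this
    exact absurd this (ZFSet.mem_irrefl _)

theorem natZF_subset {i j : ℕ} : natZF i ⊆ natZF j ↔ i ≤ j := by
  constructor
  · intro h
    by_contra hc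
    have : natZF j ∈ natZF j := h ((mem_natZF _ _).2 ⟨j, by omega, rfl⟩)
    exact ZFSet.mem_irrefl _ this
  · intro h x hx
    obtain ⟨a, ha, rfl⟩ := (mem_natZF _ _).1 hx
    exact (mem_natZF _ _).2 ⟨a, by omega, rfl⟩

theorem pair_mem_listBoolZF (x b : ZFSet) (l : List Bool) :
    ZFSet.pair x b ∈ listBoolZF l ↔
      ∃ i : Fin l.length, natZF i = x ∧ natZF (if l.get i then 1 else 0) = b := by
  simp only [listBoolZF, ZFSet.mem_range, ZFSet.pair_inj, Set.mem_range]

theorem listBoolZF_inj {l l' : List Bool} (h : listBoolZF l = listBoolZF l') : l = l' := by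
  have key : ∀ (l l' : List Bool), listBoolZF l = listBoolZF l' → ∀ i (hi : i < l.length),
      ∃ hi' : i < l'.length, l[i] = l'[i] := by
    intro l l' h i hi
    have h1 := (pair_mem_listBoolZF _ _ l).2 ⟨⟨i, hi⟩, rfl, rfl⟩
    rw [h, pair_mem_listBoolZF] at h1
    obtain ⟨⟨j, hj⟩, hij, hv⟩ := h1
    obtain rfl : j = i := natZF_inj hij
    refine ⟨hj, ?_⟩
    have := natZF_inj hv
    simp only [List.get_eq_getElem] at this
    cases hA : l[j] <;> cases hB : l'[j] <;> simp_all
  apply List.ext_getElem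
  · apply le_antisymm
    · by_contra hc
      obtain ⟨h1, _⟩ := key l l' h l'.length (by omega)
      omega
    · by_contra hc
      obtain ⟨h1, _⟩ := key l' l h.symm l.length (by omega)
      omega
  · intro i hi hi'
    exact (key l l' h i hi).2

theorem mem_treeZF (x : ZFSet) (T : Set (List Bool)) :
    x ∈ treeZF T ↔ ∃ t ∈ T, listBoolZF t = x := by
  simp [treeZF, ZFSet.mem_range]

theorem listBoolZF_mem_treeZF {t : List Bool} {T : Set (List Bool)} :
    listBoolZF t ∈ treeZF T ↔ t ∈ T := by
  rw [mem_treeZF]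
  constructor
  · rintro ⟨s, hs, h⟩
    exact listBoolZF_inj h ▸ hs
  · intro h
    exact ⟨t, h, rfl⟩

theorem treeZF_subset {T Q : Set (List Bool)} : treeZF T ⊆ treeZF Q ↔ T ⊆ Q := by
  constructor
  · intro h t ht
    exact listBoolZF_mem_treeZF.1 (h (listBoolZF_mem_treeZF.2 ht))
  · intro h x hx
    obtain ⟨t, ht, rfl⟩ := (mem_treeZF _ _).1 hx
    exact listBoolZF_mem_treeZF.2 (h ht)

theorem treeZF_inj {T Q : Set (List Bool)} (h : treeZF T = treeZF Q) : T = Q :=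
  Set.Subset.antisymm (treeZF_subset.1 (h ▸ fun _ hx => hx))
    (treeZF_subset.1 (h ▸ fun _ hx => hx))

theorem mem_umSetZF (x : ZFSet) (D : Set UMCond) :
    x ∈ umSetZF D ↔ ∃ q ∈ D, umCondZF q = x := by
  simp only [umSetZF, ZFSet.mem_range, Set.mem_range, Subtype.exists, exists_prop]

/-- The agreement relation on codes. -/
def agrZ (n Q T : ZFSet) : Prop :=
  ∀ s, s ∈ Q → (s ∈ T ∨ ∃ z, z ∈ s ∧ ∃ b, z = ZFSet.pair n b)

theorem agrZ_tree (x : ZFSet) (Q T : Set (List Bool)) :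
    agrZ x (treeZF Q) (treeZF T) ↔ ∀ s ∈ Q, s ∈ T ∨ ∃ i < s.length, natZF i = x := by
  have h1 : ∀ s : List Bool, (∃ z, z ∈ listBoolZF s ∧ ∃ b, z = ZFSet.pair x b) ↔
      ∃ i < s.length, natZF i = x := by
    intro s
    constructor
    · rintro ⟨z, hz, b, rfl⟩
      obtain ⟨i, hi, _⟩ := (pair_mem_listBoolZF _ _ _).1 hz
      exact ⟨i, i.2, hi⟩
    · rintro ⟨i, hi, h⟩
      exact ⟨_, (pair_mem_listBoolZF x _ s).2 ⟨⟨i, hi⟩, h, rfl⟩, _, rfl⟩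
  constructor
  · intro h s hs
    have := h _ (listBoolZF_mem_treeZF.2 hs)
    rwa [listBoolZF_mem_treeZF, h1] at this
  · intro h y hy
    obtain ⟨s, hs, rfl⟩ := (mem_treeZF _ _).1 hy
    rw [listBoolZF_mem_treeZF, h1]
    exact h s hs

theorem agrZ_nat (n : ℕ) (Q T : Set (List Bool)) :
    agrZ (natZF n) (treeZF Q) (treeZF T) ↔ agr T Q n := by
  rw [agrZ_tree]
  refine forall₂_congr fun s _ => or_congr Iff.rfl ?_
  constructor
  · rintro ⟨i, hi, h⟩
    exact natZF_inj h ▸ hi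
  · intro h
    exact ⟨n, h, rfl⟩

theorem agrZ_not_nat (x : ZFSet) (hx : ∀ i, natZF i ≠ x) (Q T : Set (List Bool)) :
    agrZ x (treeZF Q) (treeZF T) ↔ ∀ n, agr T Q n := by
  rw [agrZ_tree]
  constructor
  · intro h n s hs
    rcases h s hs with h | ⟨i, _, h⟩
    · exact Or.inl h
    · exact absurd h (hx i)
  · intro h s hs
    rcases h s.length s hs with h | h
    · exact Or.inl h
    · omega

theorem agrZ_congr {Q Q' T : Set (List Bool)} (h : ∀ n, agr T Q n ↔ agr T Q' n) (x : ZFSet) :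
    agrZ x (treeZF Q) (treeZF T) ↔ agrZ x (treeZF Q') (treeZF T) := by
  by_cases hx : ∃ i, natZF i = x
  · obtain ⟨i, rfl⟩ := hx
    rw [agrZ_nat, agrZ_nat, h]
  · push Not at hx
    rw [agrZ_not_nat x hx, agrZ_not_nat x hx]
    exact forall_congr' h

/-! ### Satisfaction -/

section Sat

variable {M : ZFSet} {n : ℕ}

theorem sat_mem (i j : Fin n) (v : Fin n → ZFSet) : SatM M (.mem i j) v ↔ v i ∈ v j := Iff.rfl
theorem sat_eq (i j : Fin n) (v : Fin n → ZFSet) : SatM M (.eq i j) v ↔ v i = v j := Iff.rfl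
theorem sat_imp (φ ψ : Fml n) (v : Fin n → ZFSet) :
    SatM M (.imp φ ψ) v ↔ (SatM M φ v → SatM M ψ v) := Iff.rfl
theorem sat_neg (φ : Fml n) (v : Fin n → ZFSet) : SatM M (.neg φ) v ↔ ¬ SatM M φ v := Iff.rfl
theorem sat_all (φ : Fml (n + 1)) (v : Fin n → ZFSet) :
    SatM M (.all φ) v ↔ ∀ x, x ∈ M → SatM M φ (Matrix.vecCons x v) := Iff.rfl
theorem sat_and (φ ψ : Fml n) (v : Fin n → ZFSet) :
    SatM M (.and φ ψ) v ↔ (SatM M φ v ∧ SatM M ψ v) := by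
  simp only [Fml.and, sat_neg, sat_imp]; tauto
theorem sat_or (φ ψ : Fml n) (v : Fin n → ZFSet) :
    SatM M (.or φ ψ) v ↔ (SatM M φ v ∨ SatM M ψ v) := by
  simp only [Fml.or, sat_neg, sat_imp]; tauto
theorem sat_iff (φ ψ : Fml n) (v : Fin n → ZFSet) :
    SatM M (.iff φ ψ) v ↔ (SatM M φ v ↔ SatM M ψ v) := by
  simp only [Fml.iff, sat_and, sat_imp]; tauto
theorem sat_ex (φ : Fml (n + 1)) (v : Fin n → ZFSet) :
    SatM M (.ex φ) v ↔ ∃ x, x ∈ M ∧ SatM M φ (Matrix.vecCons x v) := by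
  simp only [Fml.ex, sat_neg, sat_all]; push Not; rfl

theorem sat_rename {m : ℕ} (φ : Fml m) : ∀ {k : ℕ} (r : Fin m → Fin k) (v : Fin k → ZFSet),
    SatM M (φ.rename r) v ↔ SatM M φ (v ∘ r) := by
  induction φ with
  | mem i j => intro k r v; rfl
  | eq i j => intro k r v; rfl
  | imp φ ψ h1 h2 => intro k r v; simp only [Fml.rename, sat_imp, h1, h2]
  | neg φ h => intro k r v; simp only [Fml.rename, sat_neg, h]
  | all φ h =>
    intro k r v
    simp only [Fml.rename, sat_all, h]
    refine forall₂_congr fun x _ => ?_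
    have : (Matrix.vecCons x v ∘ fun i => Fin.cases 0 (fun j => (r j).succ) i) =
        Matrix.vecCons x (v ∘ r) := by
      funext i
      refine Fin.cases ?_ (fun j => ?_) i <;> simp
    rw [this]

theorem sep_mem (hM : IsTransModelZFC M) (φ : Fml (n + 1)) (a : ZFSet) (ha : a ∈ M)
    (p : Fin n → ZFSet) (hp : ∀ i, p i ∈ M) :
    ZFSet.sep (fun x => SatM M φ (Matrix.vecCons x p)) a ∈ M := by
  have h := hM.2.2.2.2.2.2.2.2.1 n φ (Matrix.vecCons a p)
    (fun i => Fin.cases ha (fun j => hp j) i)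
  simp only [axSep, sat_ex, sat_all, sat_iff, sat_and, sat_mem, sat_rename] at h
  obtain ⟨y, hy, h⟩ := h
  convert hy
  ext x
  have hv : (Matrix.vecCons x (Matrix.vecCons y (Matrix.vecCons a p)) ∘
      fun i => Fin.cases 0 (fun j => j.succ.succ.succ) i) = Matrix.vecCons x p := by
    funext i
    refine Fin.cases ?_ (fun j => ?_) i <;> simp
  rw [ZFSet.mem_sep]
  constructor
  · rintro ⟨h1, h2⟩
    exact (h x (hM.1.mem_trans h1 ha)).2 ⟨h1, hv ▸ h2⟩
  · intro h1
    have := (h x (hM.1.mem_trans h1 hy)).1 h1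
    exact ⟨this.1, hv ▸ this.2⟩

theorem union_bound (hM : IsTransModelZFC M) {a : ZFSet} (ha : a ∈ M) :
    ∃ y ∈ M, ∀ z ∈ a, ∀ w ∈ z, w ∈ y := by
  have h := hM.2.2.2.1 ![a] (by simpa using ha)
  simp [axUnion, sat_ex, sat_all, sat_imp, sat_and, sat_mem] at h
  obtain ⟨y, hy, h⟩ := h
  refine ⟨y, hy, fun z hz w hw => ?_⟩
  have hzM := hM.1.mem_trans hz ha
  exact h z hzM w (hM.1.mem_trans hw hzM) hw hz

theorem power_bound (hM : IsTransModelZFC M) {a : ZFSet} (ha : a ∈ M) :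
    ∃ y ∈ M, ∀ z ∈ M, z ⊆ a → z ∈ y := by
  have h := hM.2.2.2.2.1 ![a] (by simpa using ha)
  simp [axPower, sat_ex, sat_all, sat_imp, sat_mem] at h
  obtain ⟨y, hy, h⟩ := h
  exact ⟨y, hy, fun z hz hza => h z hz fun x _ hx => hza hx⟩

theorem upair_mem (hM : IsTransModelZFC M) {a b : ZFSet} (ha : a ∈ M) (hb : b ∈ M) :
    ({a, b} : ZFSet) ∈ M := by
  have h := hM.2.2.1 ![a, b] (by intro i; fin_cases i <;> simpa)
  simp [axPair, sat_ex, sat_and, sat_mem] at h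
  obtain ⟨y, hy, h1, h2⟩ := h
  have := sep_mem hM (.or (.eq 0 1) (.eq 0 2)) y hy ![a, b] (by intro i; fin_cases i <;> simpa)
  convert this using 1
  ext x
  simp [sat_or, sat_eq]
  rintro (rfl | rfl) <;> assumption

theorem pair_mem_M (hM : IsTransModelZFC M) {a b : ZFSet} (ha : a ∈ M) (hb : b ∈ M) :
    ZFSet.pair a b ∈ M := by
  have h1 : ({a} : ZFSet) ∈ M := by
    have := upair_mem hM ha ha
    simpa using this
  exact upair_mem hM h1 (upair_mem hM ha hb)

theorem of_pair_mem_M (hM : IsTransModelZFC M) {a b : ZFSet} (h : ZFSet.pair a b ∈ M) :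
    a ∈ M ∧ b ∈ M := by
  have h1 : ({a, b} : ZFSet) ∈ M := hM.1.mem_trans (by simp [ZFSet.pair]) h
  exact ⟨hM.1.mem_trans (by simp) h1, hM.1.mem_trans (by simp) h1⟩

theorem natZF_mem_M (hM : IsTransModelZFC M) (k : ℕ) : natZF k ∈ M := by
  have h := hM.2.2.2.2.2.1 ![] (by simp)
  simp [axInf, sat_ex, sat_all, sat_imp, sat_and, sat_mem, sat_neg, sat_iff, sat_or, sat_eq] at h
  obtain ⟨I, hI, ⟨e, he, heI, hemp⟩, hs⟩ := h
  suffices natZF k ∈ I from hM.1.mem_trans this hI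
  induction k with
  | zero =>
    have : e = ∅ := by
      rw [ZFSet.eq_empty]
      exact fun y hy => hemp y (hM.1.mem_trans hy he) hy
    rw [natZF, ← this]
    exact heI
  | succ k ih =>
    have hkM := hM.1.mem_trans ih hI
    obtain ⟨y, hyM, hyI, -, hy⟩ := hs _ hkM ih
    have : natZF (k + 1) = y := by
      ext z
      rw [natZF, ZFSet.mem_insert_iff]
      constructor
      · rintro (rfl | hz)
        · exact (hy _ hkM).2 (Or.inr rfl)
        · exact (hy z (hM.1.mem_trans hz hkM)).2 (Or.inl hz)
      · intro hz
        exact ((hy z (hM.1.mem_trans hz hyM)).1 hz).symm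
    rw [this]
    exact hyI

theorem choice_M (hM : IsTransModelZFC M) {F : ZFSet} (hF : F ∈ M)
    (hne : ∀ A ∈ F, ∃ x, x ∈ A) (hdisj : ∀ A ∈ F, ∀ B ∈ F, ∀ x, x ∈ A → x ∈ B → A = B) :
    ∃ C ∈ M, ∀ A ∈ F, ∃ z ∈ A, z ∈ C ∧ ∀ w ∈ A, w ∈ C → w = z := by
  have h := hM.2.2.2.2.2.2.2.1 ![F] (by simpa using hF)
  simp [axChoice, sat_ex, sat_all, sat_imp, sat_and, sat_mem, sat_neg, sat_eq] at h
  obtain ⟨C, hC, h⟩ := h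
    (fun A hA hAF => by
      obtain ⟨x, hx⟩ := hne A hAF
      exact ⟨x, hM.1.mem_trans hx hA, hx⟩)
    (fun A _ hAF B _ hBF hAB x _ hxA hxB => hAB (hdisj A hAF B hBF x hxA hxB))
  refine ⟨C, hC, fun A hA => ?_⟩
  have hAM := hM.1.mem_trans hA hF
  obtain ⟨z, hz, hzA, hzC, h⟩ := h A hAM hA
  exact ⟨z, hzA, hzC, fun w hw hwC => h w (hM.1.mem_trans hw hAM) hw hwC⟩

/-- `v i = {v j, v k}`. -/
def fUp (i j k : Fin n) : Fml n :=
  .all (.iff (.mem 0 i.succ) (.or (.eq 0 j.succ) (.eq 0 k.succ)))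

/-- `v i = (v j, v k)`. -/
def fPair (i j k : Fin n) : Fml n :=
  .ex (.ex (.and (fUp 0 j.succ.succ j.succ.succ) (.and (fUp 1 j.succ.succ k.succ.succ)
    (fUp i.succ.succ 0 1))))

theorem sat_fUp (hM : IsTransModelZFC M) (i j k : Fin n) (v : Fin n → ZFSet)
    (hv : ∀ i, v i ∈ M) : SatM M (fUp i j k) v ↔ v i = {v j, v k} := by
  simp only [fUp, sat_all, sat_iff, sat_or, sat_eq, sat_mem, Matrix.cons_val_zero,
    Matrix.cons_val_succ]
  constructor
  · intro h
    ext x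
    rw [ZFSet.mem_pair]
    constructor
    · intro hx
      exact (h x (hM.1.mem_trans hx (hv i))).1 hx
    · rintro (rfl | rfl)
      · exact (h _ (hv j)).2 (Or.inl rfl)
      · exact (h _ (hv k)).2 (Or.inr rfl)
  · intro h x _
    rw [h, ZFSet.mem_pair]

theorem vecCons_mem {x : ZFSet} (hx : x ∈ M) {v : Fin n → ZFSet} (hv : ∀ i, v i ∈ M) :
    ∀ i, Matrix.vecCons x v i ∈ M := fun i => Fin.cases hx hv i

theorem sat_fPair (hM : IsTransModelZFC M) (i j k : Fin n) (v : Fin n → ZFSet)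
    (hv : ∀ i, v i ∈ M) : SatM M (fPair i j k) v ↔ v i = ZFSet.pair (v j) (v k) := by
  have e1 : ({v j, v j} : ZFSet) = {v j} := by simp
  simp only [fPair, sat_ex, sat_and]
  constructor
  · rintro ⟨x, hx, y, hy, h1, h2, h3⟩
    rw [sat_fUp hM _ _ _ _ (vecCons_mem hy (vecCons_mem hx hv))] at h1 h2 h3
    simp at h1 h2 h3
    rw [h3, h1, h2]
    rfl
  · intro h
    have h1 := upair_mem hM (hv j) (hv j)
    have h2 := upair_mem hM (hv j) (hv k)
    refine ⟨{v j, v k}, h2, {v j, v j}, h1, ?_⟩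
    simp only [sat_fUp hM _ _ _ _ (vecCons_mem h1 (vecCons_mem h2 hv))]
    simp
    rw [h]
    rfl

/-- `agrZ (v x) (v Q) (v T)`. -/
def fAgr (x Q T : Fin n) : Fml n :=
  .all (.imp (.mem 0 Q.succ) (.or (.mem 0 T.succ)
    (.ex (.and (.mem 0 1) (.ex (fPair 1 x.succ.succ.succ 0))))))

theorem sat_fAgr (hM : IsTransModelZFC M) (x Q T : Fin n) (v : Fin n → ZFSet)
    (hv : ∀ i, v i ∈ M) : SatM M (fAgr x Q T) v ↔ agrZ (v x) (v Q) (v T) := by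
  simp only [fAgr, sat_all, sat_imp, sat_or, sat_ex, sat_and, sat_mem]
  have key : ∀ s ∈ M, ((∃ z, z ∈ M ∧ (Matrix.vecCons z (Matrix.vecCons s v) 0 ∈
        Matrix.vecCons z (Matrix.vecCons s v) 1 ∧ ∃ b, b ∈ M ∧ SatM M (fPair 1 x.succ.succ.succ 0)
          (Matrix.vecCons b (Matrix.vecCons z (Matrix.vecCons s v))))) ↔
      ∃ z, z ∈ s ∧ ∃ b, z = ZFSet.pair (v x) b) := by
    intro s hs
    constructor
    · rintro ⟨z, hz, hzs, b, hb, h⟩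
      rw [sat_fPair hM _ _ _ _ (vecCons_mem hb (vecCons_mem hz (vecCons_mem hs hv)))] at h
      exact ⟨z, hzs, b, by simpa using h⟩
    · rintro ⟨z, hzs, b, h⟩
      have hz := hM.1.mem_trans hzs hs
      have hb := (of_pair_mem_M hM (h ▸ hz)).2
      refine ⟨z, hz, hzs, b, hb, ?_⟩
      rw [sat_fPair hM _ _ _ _ (vecCons_mem hb (vecCons_mem hz (vecCons_mem hs hv)))]
      simpa using h
  constructor
  · intro h s hs
    have hsM := hM.1.mem_trans hs (hv Q)
    have := h s hsM (by simpa using hs)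
    rw [key s hsM] at this
    simpa using this
  · intro h s hsM hs
    rw [key s hsM]
    simpa using h s (by simpa using hs)

end Sat

/-! ### The sets constructed inside `M` -/

/-- The set of candidates. -/
theorem cand_mem {M : ZFSet} (hM : IsTransModelZFC M) {d t m : ZFSet} (hd : d ∈ M) (ht : t ∈ M)
    (hm : m ∈ M) : ∃ E ∈ M, ∀ x, x ∈ E ↔ (∃ k, ZFSet.pair k x ∈ d ∧ m ⊆ k) ∧ t ⊆ x := by
  obtain ⟨y, hy, hy'⟩ := union_bound hM hd
  obtain ⟨z, hz, hz'⟩ := union_bound hM hy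
  have hp : ∀ i, ![d, t, m] i ∈ M := vecCons_mem hd (vecCons_mem ht (vecCons_mem hm (by simp)))
  refine ⟨_, sep_mem hM (.and (.ex (.ex (.and (fPair 0 1 2) (.and (.mem 0 3)
    (.all (.imp (.mem 0 6) (.mem 0 2))))))) (.all (.imp (.mem 0 3) (.mem 0 1)))) z hz _ hp, ?_⟩
  intro x
  rw [ZFSet.mem_sep]
  constructor
  · rintro ⟨hxz, h⟩
    have hx := hM.1.mem_trans hxz hz
    simp only [sat_and, sat_ex] at h
    obtain ⟨⟨k, hk, q, hq, h1, h2, h3⟩, h4⟩ := h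
    rw [sat_fPair hM _ _ _ _ (vecCons_mem hq (vecCons_mem hk (vecCons_mem hx hp)))] at h1
    simp [sat_all, sat_imp, sat_mem] at h1 h2 h3 h4
    exact ⟨⟨k, h1 ▸ h2, fun w hw => h3 w (hM.1.mem_trans hw hm) hw⟩,
      fun w hw => h4 w (hM.1.mem_trans hw ht) hw⟩
  · rintro ⟨⟨k, hkd, hmk⟩, htx⟩
    have hq := hM.1.mem_trans hkd hd
    obtain ⟨hk, hx⟩ := of_pair_mem_M hM hq
    refine ⟨hz' {k, x} (hy' _ hkd _ (by simp [ZFSet.pair])) x (by simp), ?_⟩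
    simp only [sat_and, sat_ex]
    refine ⟨⟨k, hk, ZFSet.pair k x, hq, ?_, ?_, ?_⟩, ?_⟩
    · rw [sat_fPair hM _ _ _ _ (vecCons_mem hq (vecCons_mem hk (vecCons_mem hx hp)))]
      simp
    · simpa [sat_mem] using hkd
    · simp [sat_all, sat_imp, sat_mem]
      exact fun w _ hw => hmk hw
    · simp [sat_all, sat_imp, sat_mem]
      exact fun w _ hw => htx hw

/-- A choice of one candidate for each agreement pattern. -/
theorem reps_mem {M : ZFSet} (hM : IsTransModelZFC M) {E t : ZFSet} (hE : E ∈ M) (ht : t ∈ M) :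
    ∃ C ∈ M, (∀ Q ∈ E, ∃ R ∈ E, R ∈ C ∧ ∀ x ∈ M, (agrZ x Q t ↔ agrZ x R t)) ∧
      ∀ Q ∈ E, Q ∈ C → ∀ R ∈ E, R ∈ C → (∀ x ∈ M, (agrZ x Q t ↔ agrZ x R t)) → Q = R := by
  obtain ⟨P, hP, hP'⟩ := power_bound hM hE
  have hEM : ∀ {Q}, Q ∈ E → Q ∈ M := fun h => hM.1.mem_trans h hE
  -- classes are in `M`
  have hcls : ∀ Q ∈ E, ∃ A ∈ M, ∀ R, R ∈ A ↔ R ∈ E ∧ ∀ x ∈ M, (agrZ x Q t ↔ agrZ x R t) := by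
    intro Q hQ
    have hp : ∀ i, ![Q, t] i ∈ M := vecCons_mem (hEM hQ) (vecCons_mem ht (by simp))
    refine ⟨_, sep_mem hM (.all (.iff (fAgr 0 2 3) (fAgr 0 1 3))) E hE _ hp, ?_⟩
    intro R
    rw [ZFSet.mem_sep]
    refine and_congr_right fun hR => ?_
    simp only [sat_all, sat_iff]
    refine forall₂_congr fun x hx => ?_
    rw [sat_fAgr hM _ _ _ _ (vecCons_mem hx (vecCons_mem (hEM hR) hp)),
      sat_fAgr hM _ _ _ _ (vecCons_mem hx (vecCons_mem (hEM hR) hp))]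
    simp
  -- the family of classes
  have hfam : ∃ F ∈ M, ∀ A, A ∈ F ↔ A ∈ P ∧ ∃ Q ∈ E, ∀ R ∈ M,
      (R ∈ A ↔ R ∈ E ∧ ∀ x ∈ M, (agrZ x Q t ↔ agrZ x R t)) := by
    have hp : ∀ i, ![E, t] i ∈ M := vecCons_mem hE (vecCons_mem ht (by simp))
    refine ⟨_, sep_mem hM (.ex (.and (.mem 0 2) (.all (.iff (.mem 0 2) (.and (.mem 0 3)
      (.all (.iff (fAgr 0 2 5) (fAgr 0 1 5)))))))) P hP _ hp, ?_⟩
    intro A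
    rw [ZFSet.mem_sep]
    refine and_congr_right fun hA => ?_
    have hAM := hM.1.mem_trans hA hP
    have key : ∀ Q ∈ M, ∀ R ∈ M, ∀ x ∈ M,
        ((SatM M (fAgr 0 2 5) (Matrix.vecCons x (Matrix.vecCons R (Matrix.vecCons Q
          (Matrix.vecCons A ![E, t])))) ↔ SatM M (fAgr 0 1 5) (Matrix.vecCons x (Matrix.vecCons R
          (Matrix.vecCons Q (Matrix.vecCons A ![E, t]))))) ↔ (agrZ x Q t ↔ agrZ x R t)) := by
      intro Q hQ R hR x hx
      rw [sat_fAgr hM _ _ _ _ (vecCons_mem hx (vecCons_mem hR (vecCons_mem hQ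
        (vecCons_mem hAM hp)))), sat_fAgr hM _ _ _ _ (vecCons_mem hx (vecCons_mem hR
        (vecCons_mem hQ (vecCons_mem hAM hp))))]
      rfl
    simp only [sat_ex, sat_and, sat_all, sat_iff, sat_mem]
    constructor
    · rintro ⟨Q, hQ, hQE, h⟩
      refine ⟨Q, hQE, fun R hR => (h R hR).trans (and_congr Iff.rfl ?_)⟩
      exact forall₂_congr fun x hx => key Q hQ R hR x hx
    · rintro ⟨Q, hQE, h⟩
      refine ⟨Q, hEM hQE, hQE, fun R hR => (h R hR).trans (and_congr Iff.rfl ?_)⟩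
      exact forall₂_congr fun x hx => (key Q (hEM hQE) R hR x hx).symm
  obtain ⟨F, hF, hF'⟩ := hfam
  have hFcls : ∀ A ∈ F, ∃ Q ∈ E, ∀ R, R ∈ A ↔ R ∈ E ∧ ∀ x ∈ M, (agrZ x Q t ↔ agrZ x R t) := by
    intro A hA
    obtain ⟨hAP, Q, hQ, h⟩ := (hF' A).1 hA
    refine ⟨Q, hQ, fun R => ?_⟩
    constructor
    · intro hR
      exact (h R (hM.1.mem_trans hR (hM.1.mem_trans hAP hP))).1 hR
    · intro hR
      exact (h R (hEM hR.1)).2 hR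
  obtain ⟨C, hC, hC'⟩ := choice_M hM hF
    (by
      intro A hA
      obtain ⟨Q, hQ, h⟩ := hFcls A hA
      exact ⟨Q, (h Q).2 ⟨hQ, fun _ _ => Iff.rfl⟩⟩)
    (by
      intro A hA B hB x hxA hxB
      obtain ⟨Q, hQ, h⟩ := hFcls A hA
      obtain ⟨R, hR, h'⟩ := hFcls B hB
      have h1 := ((h x).1 hxA).2
      have h2 := ((h' x).1 hxB).2
      ext z
      rw [h, h']
      refine and_congr_right fun _ => forall₂_congr fun y hy => ?_
      rw [h1 y hy, h2 y hy])
  have hclsF : ∀ Q ∈ E, ∃ A ∈ F, ∀ R, R ∈ A ↔ R ∈ E ∧ ∀ x ∈ M, (agrZ x Q t ↔ agrZ x R t) := by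
    intro Q hQ
    obtain ⟨A, hA, h⟩ := hcls Q hQ
    exact ⟨A, (hF' A).2 ⟨hP' A hA fun R hR => ((h R).1 hR).1, Q, hQ, fun R _ => h R⟩, h⟩
  refine ⟨C, hC, ?_, ?_⟩
  · intro Q hQ
    obtain ⟨A, hA, h⟩ := hclsF Q hQ
    obtain ⟨z, hzA, hzC, _⟩ := hC' A hA
    exact ⟨z, ((h z).1 hzA).1, hzC, ((h z).1 hzA).2⟩
  · intro Q hQ hQC R hR hRC hag
    obtain ⟨A, hA, h⟩ := hclsF Q hQ
    obtain ⟨z, hzA, hzC, hz⟩ := hC' A hA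
    rw [hz Q ((h Q).2 ⟨hQ, fun _ _ => Iff.rfl⟩) hQC, hz R ((h R).2 ⟨hR, hag⟩) hRC]

/-- The union of the chosen candidates. -/
theorem runion_mem {M : ZFSet} (hM : IsTransModelZFC M) {E C : ZFSet} (hE : E ∈ M) (hC : C ∈ M) :
    ∃ S ∈ M, ∀ s, s ∈ S ↔ ∃ Q ∈ E, Q ∈ C ∧ s ∈ Q := by
  obtain ⟨y, hy, hy'⟩ := union_bound hM hE
  have hp : ∀ i, ![E, C] i ∈ M := vecCons_mem hE (vecCons_mem hC (by simp))
  refine ⟨_, sep_mem hM (.ex (.and (.mem 0 2) (.and (.mem 0 3) (.mem 1 0)))) y hy _ hp, ?_⟩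
  intro s
  rw [ZFSet.mem_sep]
  simp only [sat_ex, sat_and, sat_mem]
  constructor
  · rintro ⟨_, Q, _, h1, h2, h3⟩
    exact ⟨Q, h1, h2, h3⟩
  · rintro ⟨Q, h1, h2, h3⟩
    exact ⟨hy' Q h1 s h3, Q, hM.1.mem_trans h1 hE, h1, h2, h3⟩

/-- Let `M` be a transitive model of ZFC and `U` a perfect nowhere dense tree on `{0,1}`
that `𝕌𝕄`-dominates `M`. If `D ∈ M` is a dense subset of the universal meager forcing as
computed in `M`, then `D ∩ 𝕌𝕄(U)` is dense in `𝕌𝕄(U) ∩ M`. -/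
theorem universal_meager_restricted_density (M : ZFSet) (hM : IsTransModelZFC M)
    (U : Set (List Bool)) (hU : NWD U) (hUdom : UMDominates M U)
    (D : Set UMCond)
    (hDinM : umSetZF D ∈ M)
    (hDsub : ∀ p ∈ D, umCondZF p ∈ M ∧ NWD p.2)
    (hDdense : ∀ p : UMCond, umCondZF p ∈ M → NWD p.2 → ∃ q ∈ D, umLe q p) :
    ∀ p : UMCond, umCondZF p ∈ M → NWD p.2 → p.2 ⊆ U →
      ∃ q ∈ D, q.2 ⊆ U ∧ umLe q p := by
  rintro ⟨m, T⟩ hpM hT hTU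
  simp only at hT hTU
  obtain ⟨hmM, hTM⟩ := of_pair_mem_M hM hpM
  simp only at hmM hTM
  obtain ⟨E, hE, hE'⟩ := cand_mem hM hDinM hTM hmM
  -- elements of `E`
  have hEout : ∀ x ∈ E, ∃ q ∈ D, x = treeZF q.2 ∧ m ≤ q.1 ∧ T ⊆ q.2 := by
    intro x hx
    obtain ⟨⟨k, hk, hmk⟩, hTx⟩ := (hE' x).1 hx
    obtain ⟨q, hq, hqe⟩ := (mem_umSetZF _ _).1 hk
    obtain ⟨h1, h2⟩ := ZFSet.pair_inj.1 hqe
    subst h1 h2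
    exact ⟨q, hq, rfl, natZF_subset.1 hmk, treeZF_subset.1 hTx⟩
  have hEin : ∀ q ∈ D, m ≤ q.1 → T ⊆ q.2 → treeZF q.2 ∈ E := by
    intro q hq h1 h2
    exact (hE' _).2 ⟨⟨natZF q.1, (mem_umSetZF _ _).2 ⟨q, hq, rfl⟩, natZF_subset.2 h1⟩,
      treeZF_subset.2 h2⟩
  obtain ⟨C, hC, hC1, hC2⟩ := reps_mem hM hE hTM
  obtain ⟨Sz, hSz, hSz'⟩ := runion_mem hM hE hC
  let 𝒞 : Set (Set (List Bool)) := {Q | treeZF Q ∈ E ∧ treeZF Q ∈ C}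
  have hS : treeZF (⋃₀ 𝒞) = Sz := by
    ext s
    rw [hSz', mem_treeZF]
    constructor
    · rintro ⟨l, ⟨Q, hQ, hl⟩, rfl⟩
      exact ⟨treeZF Q, hQ.1, hQ.2, listBoolZF_mem_treeZF.2 hl⟩
    · rintro ⟨Q, hQE, hQC, hs⟩
      obtain ⟨q, _, rfl, _⟩ := hEout Q hQE
      obtain ⟨l, hl, rfl⟩ := (mem_treeZF _ _).1 hs
      exact ⟨l, ⟨q.2, ⟨hQE, hQC⟩, hl⟩, rfl⟩
  have hCD : ∀ Q ∈ 𝒞, ∃ q ∈ D, q.2 = Q ∧ m ≤ q.1 ∧ T ⊆ Q ∧ NWD Q := by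
    intro Q hQ
    obtain ⟨q, hq, h1, h2, h3⟩ := hEout _ hQ.1
    have h4 := treeZF_inj h1
    subst h4
    exact ⟨q, hq, rfl, h2, h3, (hDsub q hq).2⟩
  -- for every level a chosen tree agreeing with `T` up to it
  have hlev : ∀ n, m ≤ n → ∃ Q ∈ 𝒞, agr T Q n := by
    intro n hn
    obtain ⟨q, hq, hle⟩ := hDdense (n, T) (pair_mem_M hM (natZF_mem_M hM n) hTM) hT
    obtain ⟨h1, h2, h3⟩ := hle
    simp only at h1 h2 h3
    have ha : agr T q.2 n := agr_of_level hT.1.2.1 (hDsub q hq).2.1 h3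
    obtain ⟨R, hR, hRC, hRa⟩ := hC1 _ (hEin q hq (hn.trans h1) h2)
    obtain ⟨r, hr, rfl, _⟩ := hEout R hR
    refine ⟨r.2, ⟨hR, hRC⟩, ?_⟩
    rw [← agrZ_nat, ← hRa _ (natZF_mem_M hM n), agrZ_nat]
    exact ha
  have hSnwd : NWD (⋃₀ 𝒞) := by
    refine ⟨perfect_sUnion _ ?_ ?_, nwd_sUnion T hT.2 _ ?_ ?_⟩
    · obtain ⟨Q, hQ, _⟩ := hlev m le_rfl
      exact ⟨Q, hQ⟩
    · intro Q hQ
      obtain ⟨q, _, _, _, _, h⟩ := hCD Q hQ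
      exact h.1
    · intro Q hQ
      obtain ⟨q, _, _, _, _, h⟩ := hCD Q hQ
      exact ⟨h.2, h.1.2.1⟩
    · intro Q hQ R hR h
      exact treeZF_inj (hC2 _ hQ.1 hQ.2 _ hR.1 hR.2 fun x _ => agrZ_congr h x)
  obtain ⟨n, hn⟩ := hUdom.2 (⋃₀ 𝒞) (hS ▸ hSz) hSnwd
  obtain ⟨Q, hQ, ha⟩ := hlev (max m n) (le_max_left _ _)
  obtain ⟨q, hq, rfl, hmq, hTQ, hnwd⟩ := hCD Q hQ
  refine ⟨q, hq, captured hnwd.1 hT.1.2.1 hTQ (Set.subset_sUnion_of_mem hQ) hTU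
    (le_max_right m n) ha hn, hmq, hTQ, ?_⟩
  intro l hl
  simp only at hl ⊢
  refine ⟨fun h => ?_, fun h => hTQ h⟩
  rcases ha l h with h1 | h1
  · exact h1
  · have := le_max_left m n
    omega

end
end

section
/- The cofinality of the null ideal on the reals is equal to the cofinality of the partial order of open sets of reals of finite Lebesgue measure, ordered by inclusion. -/
noncomputable section

open MeasureTheory

/-- The cofinality of the null ideal on `ℝ`: the least cardinality of a family of null sets
such that every null set is contained in one of them. -/
def nullCof : Cardinal :=
  sInf {c | ∃ B : Set (Set ℝ), (∀ Y ∈ B, volume Y = 0) ∧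
    (∀ X : Set ℝ, volume X = 0 → ∃ Y ∈ B, X ⊆ Y) ∧ Cardinal.mk B = c}

/-- The cofinality of the partial order of open subsets of `ℝ` of finite Lebesgue measure,
ordered by inclusion: the least cardinality of a cofinal family. -/
def finiteMeasureOpenCof : Cardinal :=
  sInf {c | ∃ C : Set (Set ℝ), (∀ O ∈ C, IsOpen O ∧ volume O < ⊤) ∧
    (∀ O : Set ℝ, IsOpen O → volume O < ⊤ → ∃ O' ∈ C, O ⊆ O') ∧ Cardinal.mk C = c}

open Set Filter Topology ProbabilityTheory unitInterval
open scoped ENNReal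

lemma aux_events (w : ℕ → ℝ≥0∞) (hw : ∀ n, w n ≤ 1) :
    ∃ E : ℕ → Set I, (∀ n, MeasurableSet (E n)) ∧ (∀ n, volume (E n) = w n) ∧
      ∀ S : Set ℕ, ∑' n : S, w n = ∞ → volume (⋃ n ∈ S, E n)ᶜ = 0 := by
  classical
  obtain ⟨ψ, hψ, hψm⟩ := Measure.exists_measurable_map_eq
    (Measure.infinitePi (fun _ : ℕ => (volume : Measure I)))
  have hww : ∀ n, (w n).toReal ∈ I := fun n =>
    ⟨ENNReal.toReal_nonneg, ENNReal.toReal_le_of_le_ofReal zero_le_one (by simpa using hw n)⟩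
  let T : ℕ → Set I := fun n => Iic ⟨_, hww n⟩
  have hT : ∀ n, MeasurableSet (T n) := fun n => measurableSet_Iic
  have hmp : MeasurePreserving ψ volume (Measure.infinitePi (fun _ : ℕ => (volume : Measure I))) :=
    ⟨hψ, hψm⟩
  have key : ∀ (n) (U : Set I), MeasurableSet U →
      volume ((fun x => ψ x n) ⁻¹' U) = volume U := by
    intro n U hU
    have h2 := measurePreserving_eval_infinitePi (fun _ : ℕ => (volume : Measure I)) n
    exact (h2.comp hmp).measure_preimage hU.nullMeasurableSet
  have hE : ∀ n, volume ((fun x => ψ x n) ⁻¹' T n) = w n := by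
    intro n
    rw [key n _ (hT n)]
    simp only [T, unitInterval.volume_Iic]
    exact ENNReal.ofReal_toReal (ne_top_of_le_ne_top ENNReal.one_ne_top (hw n))
  refine ⟨fun n => (fun x => ψ x n) ⁻¹' T n, fun n => (by fun_prop : Measurable fun x => ψ x n) (hT n),
    hE, ?_⟩
  intro S hS
  let T' : ℕ → Set I := fun n => if n ∈ S then T n else ∅
  have hT' : ∀ n, MeasurableSet (T' n) := by
    intro n; simp only [T']; split_ifs; exacts [hT n, MeasurableSet.empty]
  have hm' : ∀ n, MeasurableSet ((fun x => ψ x n) ⁻¹' T' n) :=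
    fun n => (by fun_prop : Measurable fun x => ψ x n) (hT' n)
  have hind0 : iIndepFun (fun (i : ℕ) (ω : ℕ → I) => ω i)
      (Measure.infinitePi (fun _ : ℕ => (volume : Measure I))) :=
    iIndepFun_infinitePi (X := fun _ x => x) (fun _ => measurable_id)
  have hind : iIndepSet (fun n => (fun x => ψ x n) ⁻¹' T' n) (volume : Measure I) := by
    rw [iIndepSet_iff_meas_biInter hm']
    intro s
    have := hind0.measure_inter_preimage_eq_mul s (sets := T') (fun i _ => hT' i)
    have e1 : (⋂ i ∈ s, (fun x => ψ x i) ⁻¹' T' i)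
        = ψ ⁻¹' (⋂ i ∈ s, (fun ω : ℕ → I => ω i) ⁻¹' T' i) := by
      ext; simp
    rw [e1, hmp.measure_preimage, this]
    · refine Finset.prod_congr rfl fun i _ => ?_
      rw [key i _ (hT' i)]
      exact (measurePreserving_eval_infinitePi (fun _ : ℕ => (volume : Measure I)) i).measure_preimage
        (hT' i).nullMeasurableSet
    · refine MeasurableSet.nullMeasurableSet ?_
      exact Finset.measurableSet_biInter _ fun i _ => measurable_pi_apply i (hT' i)
  have h1 := measure_limsup_eq_one hm' hind (by
    rw [← hS, tsum_subtype S w]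
    refine tsum_congr fun n => ?_
    by_cases hn : n ∈ S
    · simp only [T', hn, if_true, indicator_of_mem]; exact hE n
    · simp [T', hn])
  have h2 : limsup (fun n => (fun x => ψ x n) ⁻¹' T' n) atTop ⊆
      ⋃ n ∈ S, (fun x => ψ x n) ⁻¹' T n := by
    intro x hx
    rw [mem_limsup_iff_frequently_mem] at hx
    obtain ⟨n, hn⟩ := hx.exists
    by_cases hnS : n ∈ S
    · simp only [T', hnS, if_true] at hn
      exact mem_biUnion hnS hn
    · simp [T', hnS] at hn
  rw [prob_compl_eq_zero_iff]
  · exact le_antisymm prob_le_one (h1 ▸ measure_mono h2)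
  · exact MeasurableSet.biUnion (to_countable S)
      fun n _ => (by fun_prop : Measurable fun x => ψ x n) (hT n)

lemma aux_open_events (w : ℕ → ℝ≥0∞) (hw : ∀ n, w n ≤ 1) :
    ∃ V : ℕ → Set I, (∀ n, IsOpen (V n)) ∧
      (∀ A : Set ℕ, ∑' n : A, w n ≠ ∞ → ∑' n : A, volume (V n) ≠ ∞) ∧
      ∀ S : Set ℕ, ∑' n : S, w n = ∞ → volume (⋃ n ∈ S, V n)ᶜ = 0 := by
  obtain ⟨E, hEm, hEw, hE⟩ := aux_events w hw
  obtain ⟨ε, hε, hεs⟩ := ENNReal.exists_pos_sum_of_countable' (one_ne_zero (α := ℝ≥0∞)) ℕ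
  have : ∀ n, ∃ V, V ⊇ E n ∧ IsOpen V ∧ volume V < volume (E n) + ε n := fun n =>
    (E n).exists_isOpen_lt_add (measure_ne_top _ _) (hε n).ne'
  choose V hV hVo hVm using this
  refine ⟨V, hVo, ?_, ?_⟩
  · intro A hA
    have h1 : ∑' n : A, volume (V n) ≤ ∑' n : A, w n + ∑' n : A, ε n := by
      rw [← ENNReal.tsum_add]
      exact ENNReal.tsum_le_tsum fun n => (hVm n).le.trans (by rw [hEw])
    have h2 : ∑' n : A, ε n ≤ 1 :=
      (ENNReal.tsum_comp_le_tsum_of_injective Subtype.val_injective ε).trans hεs.le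
    exact ne_top_of_le_ne_top
      (ENNReal.add_ne_top.2 ⟨hA, ne_top_of_le_ne_top ENNReal.one_ne_top h2⟩) h1
  · intro S hS
    refine measure_mono_null (compl_subset_compl.2 ?_) (hE S hS)
    exact iUnion₂_mono fun n _ => hV n

lemma aux_core (w : ℕ → ℝ≥0∞) (V : ℕ → Set I) (hVo : ∀ n, IsOpen (V n))
    (hV : ∀ S : Set ℕ, ∑' n : S, w n = ∞ → volume (⋃ n ∈ S, V n)ᶜ = 0)
    (Y : Set I) (hY : volume Y = 0) :
    ∃ S : ℕ → Set ℕ, (∀ i, ∑' n : S i, w n ≠ ∞) ∧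
      ∀ A : Set ℕ, (∀ x, (∀ m, ∃ n ∈ A, m ≤ n ∧ x ∈ V n) → x ∈ Y) → ∃ i, (A \ S i).Finite := by
  classical
  obtain ⟨Z, hYZ, hZm, hZ⟩ := exists_measurable_superset_of_null hY
  obtain ⟨K, hKZ, hKc, hKpos⟩ := hZm.compl.exists_lt_isClosed_of_ne_top
    (μ := (volume : Measure I)) (measure_ne_top _ _) (r := 0)
    (by rw [(prob_compl_eq_one_iff hZm).2 hZ]; exact zero_lt_one)
  set ν := (volume : Measure I).restrict K with hν
  have hν0 : ν ≠ 0 := by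
    rw [hν, Ne, Measure.restrict_eq_zero]; exact hKpos.ne'
  set L := ν.support with hL
  have hLc : IsClosed L := ν.isClosed_support
  have hLne : L.Nonempty := Measure.nonempty_support hν0
  have hLK : L ⊆ K := Measure.support_subset_of_isClosed hKc (ae_restrict_mem hKc.measurableSet)
  have hpos : ∀ U : Set I, IsOpen U → (L ∩ U).Nonempty → volume (L ∩ U) ≠ 0 := by
    rintro U hU ⟨x, hxL, hxU⟩ h0
    have h1 := (Measure.mem_support_iff_forall x).1 hxL U (hU.mem_nhds hxU)
    have h2 : ν U ≤ ν (L ∩ U) + ν Lᶜ := by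
      refine (measure_mono ?_).trans (measure_union_le _ _)
      intro y hy
      by_cases h : y ∈ L
      · exact Or.inl ⟨h, hy⟩
      · exact Or.inr h
    have h3 : ν Lᶜ = 0 := Measure.measure_compl_support
    have h4 : ν (L ∩ U) = 0 := le_antisymm ((Measure.restrict_apply_le _ _).trans h0.le) bot_le
    rw [h3, h4] at h2
    simp at h2
    exact h1.ne' h2
  obtain ⟨b, hbc, hbne, hb⟩ := TopologicalSpace.exists_countable_basis I
  have hbn : b.Nonempty := by
    obtain ⟨x⟩ := (inferInstance : Nonempty I)
    obtain ⟨u, hu, -⟩ := hb.exists_subset_of_mem_open (mem_univ x) isOpen_univ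
    exact ⟨u, hu⟩
  obtain ⟨u, hu⟩ := hbc.exists_eq_range hbn
  have huo : ∀ i, IsOpen (u i) := fun i => hb.isOpen (hu ▸ mem_range_self i)
  refine ⟨fun i => if (L ∩ u i).Nonempty then {n | L ∩ u i ∩ V n = ∅} else ∅, ?_, ?_⟩
  · intro i
    by_cases hi : (L ∩ u i).Nonempty
    · intro htop
      refine hpos _ (huo i) hi (measure_mono_null ?_ (hV _ htop))
      intro x hx hx'
      simp only [mem_iUnion] at hx'
      obtain ⟨n, hn, hxn⟩ := hx'
      have : x ∈ L ∩ u i ∩ V n := ⟨hx, hxn⟩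
      rw [if_pos hi] at hn
      rw [show L ∩ u i ∩ V n = ∅ from hn] at this
      exact this
    · simp [hi]
  · intro A hA
    by_contra! hcon
    have : CompactSpace L := isCompact_iff_compactSpace.1 hLc.isCompact
    have : Nonempty L := hLne.to_subtype
    let G : ℕ → Set L := fun m => Subtype.val ⁻¹' (⋃ n ∈ {n | n ∈ A ∧ m ≤ n}, V n)
    have hGo : ∀ m, IsOpen (G m) := fun m =>
      (isOpen_biUnion fun n _ => hVo n).preimage continuous_subtype_val
    have hGd : ∀ m, Dense (G m) := by
      intro m
      rw [dense_iff_inter_open]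
      rintro W hW ⟨x, hxW⟩
      obtain ⟨W', hW', rfl⟩ := isOpen_induced_iff.1 hW
      obtain ⟨v, hvb, hxv, hvW⟩ := hb.exists_subset_of_mem_open (show (x : I) ∈ W' from hxW) hW'
      rw [hu] at hvb
      obtain ⟨i, rfl⟩ := hvb
      have hi : (L ∩ u i).Nonempty := ⟨x, x.2, hxv⟩
      have hinf := hcon i
      simp only [hi, if_true] at hinf
      obtain ⟨n, ⟨hnA, hn⟩, hmn⟩ := Set.Infinite.exists_gt hinf m
      have hn' : (L ∩ u i ∩ V n).Nonempty := nonempty_iff_ne_empty.2 hn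
      obtain ⟨y, ⟨hyL, hyu⟩, hyV⟩ := hn'
      exact ⟨⟨y, hyL⟩, hvW hyu, mem_biUnion (show n ∈ {n | n ∈ A ∧ m ≤ n} from ⟨hnA, hmn.le⟩) hyV⟩
    obtain ⟨x, hx⟩ := (dense_iInter_of_isOpen_nat hGo hGd).nonempty
    have hxY : (x : I) ∈ Y := by
      refine hA x fun m => ?_
      have := mem_iInter.1 hx m
      simp only [G, mem_preimage, mem_iUnion] at this
      obtain ⟨n, ⟨h1, h2⟩, h3⟩ := this
      exact ⟨n, h1, h2, h3⟩
    exact hKZ (hLK x.2) (hYZ hxY)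

lemma aux_cover : ∃ J : ℕ → Set ℝ, (∀ n, IsOpen (J n)) ∧ (∀ n, volume (J n) ≠ ∞) ∧
    ∀ O : Set ℝ, volume O < ∞ → ∃ A : Set ℕ, O ⊆ ⋃ n ∈ A, J n ∧ ∑' n : A, volume (J n) ≠ ∞ := by
  obtain ⟨e, he⟩ := exists_surjective_nat (ℚ × ℚ)
  let J : ℕ → Set ℝ := fun n => Ioo ((e n).1 : ℝ) ((e n).2 : ℝ)
  refine ⟨J, fun n => isOpen_Ioo, fun n => by simp [J], ?_⟩
  intro O hO
  obtain ⟨ε, hε, hεs⟩ := ENNReal.exists_pos_sum_of_countable (one_ne_zero (α := ℝ≥0∞)) ℕ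
  have hO2 : StieltjesFunction.id.outer O < ∞ := by
    have : volume O = StieltjesFunction.id.outer O := by
      rw [Real.volume_eq_stieltjes_id, StieltjesFunction.measure_def]; rfl
    rwa [← this]
  rw [StieltjesFunction.outer, OuterMeasure.ofFunction_apply] at hO2
  simp only [iInf_lt_iff] at hO2
  obtain ⟨t, htO, hts⟩ := hO2
  have hlen : ∀ n, StieltjesFunction.id.length (t n) ≠ ∞ := fun n =>
    ne_top_of_le_ne_top hts.ne (ENNReal.le_tsum n)
  have h1 : ∀ n, ∃ k, t n ⊆ J k ∧
      volume (J k) ≤ StieltjesFunction.id.length (t n) + ε n + (ε n + ε n) := by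
    intro n
    have h2 : StieltjesFunction.id.length (t n) < StieltjesFunction.id.length (t n) + ε n :=
      ENNReal.lt_add_right (hlen n) (by simpa using (hε n).ne')
    conv_lhs at h2 => rw [StieltjesFunction.length_eq]
    simp only [iInf_lt_iff] at h2
    obtain ⟨a, b, hab, hlt⟩ := h2
    have hab' : t n ⊆ Ioc a b := by
      intro x hx
      refine hab ⟨hx, ?_⟩
      simp [botSet]
    have hεn : (0 : ℝ) < ε n := by exact_mod_cast hε n
    obtain ⟨p, hp1, hp2⟩ := exists_rat_btwn (show a - ε n < a by linarith)
    obtain ⟨q, hq1, hq2⟩ := exists_rat_btwn (show b < b + ε n by linarith)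
    obtain ⟨k, hk⟩ := he (p, q)
    refine ⟨k, fun x hx => ?_, ?_⟩
    · simp only [J, hk]
      exact ⟨hp2.trans (hab' hx).1, (hab' hx).2.trans_lt hq1⟩
    · simp only [J, hk, Real.volume_Ioo]
      calc ENNReal.ofReal (q - p) ≤ ENNReal.ofReal ((b - a) + (ε n + ε n)) :=
            ENNReal.ofReal_le_ofReal (by linarith)
        _ ≤ ENNReal.ofReal (b - a) + ENNReal.ofReal (ε n + ε n) := ENNReal.ofReal_add_le
        _ ≤ _ := by
          refine add_le_add hlt.le ?_
          rw [ENNReal.ofReal_add hεn.le hεn.le]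
          simp
  choose k hk1 hk2 using h1
  refine ⟨range k, ?_, ?_⟩
  · intro x hx
    obtain ⟨n, hn⟩ := mem_iUnion.1 (htO hx)
    exact mem_biUnion (mem_range_self n) (hk1 n hn)
  · have hsurj : Function.Surjective (rangeFactorization k) := rangeFactorization_surjective
    have h3 : ∑' n : range k, volume (J n) ≤ ∑' n, volume (J (k n)) := by
      have := ENNReal.tsum_comp_le_tsum_of_injective
        (Function.injective_surjInv hsurj) (fun n => volume (J (k n)))
      refine le_trans (le_of_eq (tsum_congr fun m => ?_)) this
      have h4 := congrArg Subtype.val (Function.surjInv_eq hsurj m)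
      simp only [rangeFactorization_coe] at h4
      rw [h4]
    refine ne_top_of_le_ne_top ?_ (h3.trans (ENNReal.tsum_le_tsum hk2))
    have h5 : ∑' n, (ε n : ℝ≥0∞) ≠ ∞ := ne_top_of_le_ne_top ENNReal.one_ne_top hεs.le
    rw [ENNReal.tsum_add, ENNReal.tsum_add, ENNReal.tsum_add]
    simp [ENNReal.add_ne_top, h5, hts.ne]

lemma aux_finite_union (J : ℕ → Set ℝ) (hJ : ∀ n, volume (J n) ≠ ∞) (S : Set ℕ)
    (hS : ∑' n : S, min 1 (volume (J n)) ≠ ∞) : volume (⋃ n ∈ S, J n) < ∞ := by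
  have hfin := ENNReal.finite_const_le_of_tsum_ne_top hS one_ne_zero
  set F : Set S := {i | 1 ≤ min 1 (volume (J i))} with hF
  have hsub : (⋃ n ∈ S, J n) ⊆ (⋃ n ∈ F, J n) ∪ ⋃ n : ↥(Fᶜ), J n := by
    intro x hx
    simp only [mem_iUnion] at hx
    obtain ⟨n, hn, hx⟩ := hx
    by_cases h : (⟨n, hn⟩ : S) ∈ F
    · exact Or.inl (mem_biUnion h hx)
    · exact Or.inr (mem_iUnion.2 ⟨⟨⟨n, hn⟩, h⟩, hx⟩)
  refine (measure_mono hsub).trans_lt ((measure_union_le _ _).trans_lt (ENNReal.add_lt_top.2 ⟨?_, ?_⟩))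
  · exact measure_biUnion_lt_top hfin fun i _ => (hJ i).lt_top
  · refine (measure_iUnion_le _).trans_lt ?_
    refine lt_of_le_of_lt ?_ hS.lt_top
    refine le_trans ?_ (ENNReal.tsum_comp_le_tsum_of_injective
      (Subtype.val_injective (p := fun i => i ∈ Fᶜ)) (fun n : S => min 1 (volume (J n))))
    refine ENNReal.tsum_le_tsum fun i => ?_
    have hi : ¬ (1 ≤ min 1 (volume (J i))) := i.2
    have h2 : volume (J i) < 1 := by
      by_contra h; exact hi (le_min le_rfl (not_lt.1 h))
    exact le_min h2.le le_rfl

lemma aux_null_of_translates (O : Set ℝ) (hO : IsOpen O) (hfin : volume O < ∞) :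
    volume {x : ℝ | ∀ n : ℕ, x + n ∈ O} = 0 := by
  set Y := {x : ℝ | ∀ n : ℕ, x + n ∈ O} with hY
  have hYm : MeasurableSet Y := by
    have : Y = ⋂ n : ℕ, (fun x : ℝ => x + n) ⁻¹' O := by ext; simp [hY]
    rw [this]
    exact MeasurableSet.iInter fun n => (hO.preimage (by fun_prop)).measurableSet
  have h1 : ∀ m : ℤ, volume (Y ∩ Ico (m : ℝ) (m + 1)) = 0 := by
    intro m
    set Z := Y ∩ Ico (m : ℝ) (m + 1)
    have hZm : MeasurableSet Z := hYm.inter measurableSet_Ico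
    let T : ℕ → Set ℝ := fun n => (fun x : ℝ => x + (-(n : ℝ))) ⁻¹' Z
    have hTm : ∀ n, MeasurableSet (T n) := fun n => (by fun_prop : Measurable fun x : ℝ => x + (-(n : ℝ))) hZm
    have hTv : ∀ n, volume (T n) = volume Z := fun n => measure_preimage_add_right _ _ _
    have hTO : (⋃ n, T n) ⊆ O := by
      intro x hx
      obtain ⟨n, hn⟩ := mem_iUnion.1 hx
      have := hn.1 n
      simpa using this
    have hdisj : Pairwise (Function.onFun Disjoint T) := by
      intro i j hij
      refine Set.disjoint_left.2 fun x hi hj => hij ?_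
      obtain ⟨-, hi1, hi2⟩ := hi
      obtain ⟨-, hj1, hj2⟩ := hj
      simp only at hi1 hi2 hj1 hj2
      have a1 : (i : ℝ) < j + 1 := by linarith
      have a2 : (j : ℝ) < i + 1 := by linarith
      have a3 : i < j + 1 := by exact_mod_cast a1
      have a4 : j < i + 1 := by exact_mod_cast a2
      omega
    have hsum := (measure_iUnion hdisj hTm (μ := volume)).symm.trans_le (measure_mono hTO)
    simp only [hTv] at hsum
    by_contra h0
    rw [ENNReal.tsum_const_eq_top_of_ne_zero h0] at hsum
    exact absurd hfin (not_lt.2 hsum)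
  refine measure_mono_null ?_ (measure_iUnion_null h1)
  intro x hx
  exact mem_iUnion.2 ⟨⌊x⌋, hx, Int.floor_le x, Int.lt_floor_add_one x⟩

lemma aux_le : nullCof ≤ finiteMeasureOpenCof := by
  refine le_csInf ⟨_, {O | IsOpen O ∧ volume O < ⊤}, fun _ h => h,
    fun O h1 h2 => ⟨O, ⟨h1, h2⟩, Subset.rfl⟩, rfl⟩ ?_
  rintro _ ⟨C, hC, hcof, rfl⟩
  refine le_trans (csInf_le' ⟨(fun O : Set ℝ => {x : ℝ | ∀ n : ℕ, x + n ∈ O}) '' C, ?_, ?_, rfl⟩)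
    Cardinal.mk_image_le
  · rintro _ ⟨O, hO, rfl⟩
    exact aux_null_of_translates O (hC O hO).1 (hC O hO).2
  · intro X hX
    have h0 : volume (⋃ n : ℕ, (fun x : ℝ => x + (-(n : ℝ))) ⁻¹' X) = 0 :=
      measure_iUnion_null fun n => (measure_preimage_add_right _ _ _).trans hX
    obtain ⟨U, hU, hUo, hUm⟩ := (⋃ n : ℕ, (fun x : ℝ => x + (-(n : ℝ))) ⁻¹' X).exists_isOpen_lt_add
      (μ := volume) (by rw [h0]; exact ENNReal.zero_ne_top) (one_ne_zero (α := ℝ≥0∞))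
    obtain ⟨O', hO', hUO⟩ := hcof U hUo (hUm.trans (by rw [h0]; simp))
    refine ⟨_, ⟨O', hO', rfl⟩, fun x hx n => hUO (hU (mem_iUnion.2 ⟨n, ?_⟩))⟩
    simpa using hx

lemma aux_ge : finiteMeasureOpenCof ≤ nullCof := by
  refine le_csInf ⟨_, {X | volume X = 0}, fun _ h => h, fun X h1 => ⟨X, h1, Subset.rfl⟩, rfl⟩ ?_
  rintro _ ⟨B, hB, hcof, rfl⟩
  have hBinf : Cardinal.aleph0 ≤ Cardinal.mk B := by
    by_contra hlt
    have hc : B.Countable := (Cardinal.lt_aleph0_iff_set_finite.1 (not_le.1 hlt)).countable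
    have h0 : volume (⋃₀ B) = 0 := (measure_sUnion_null_iff hc).2 hB
    have hne : ⋃₀ B ≠ univ := by
      intro h; rw [h] at h0; simp at h0
    obtain ⟨x, hx⟩ := (ne_univ_iff_exists_notMem _).1 hne
    obtain ⟨Y, hY, hxY⟩ := hcof {x} (by simp)
    exact hx ⟨Y, hY, hxY rfl⟩
  obtain ⟨J, hJo, hJf, hJ⟩ := aux_cover
  let w : ℕ → ℝ≥0∞ := fun n => min 1 (volume (J n))
  obtain ⟨V, hVo, hVs, hV⟩ := aux_open_events w fun n => min_le_left _ _
  have hval : ∀ Z : Set I, volume (Subtype.val '' Z : Set ℝ) = volume Z := fun Z =>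
    ((MeasurableEmbedding.subtype_coe measurableSet_Icc).comap_apply volume Z).symm
  have hYn : ∀ Y : B, volume (Subtype.val ⁻¹' (Y : Set ℝ) : Set I) = 0 := fun Y => by
    rw [← hval]
    exact measure_mono_null (image_preimage_subset _ _) (hB Y Y.2)
  choose S hS1 hS2 using fun Y : B => aux_core w V hVo hV _ (hYn Y)
  let Φ : B × (ℕ × Finset ℕ) → Set ℝ := fun p => (⋃ n ∈ S p.1 p.2.1, J n) ∪ ⋃ n ∈ p.2.2, J n
  have hcard : Cardinal.mk (range Φ) ≤ Cardinal.mk B := by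
    refine Cardinal.mk_range_le.trans ?_
    rw [← Cardinal.mul_def]
    refine Cardinal.mul_le_of_le hBinf le_rfl ?_
    exact Cardinal.mk_le_aleph0.trans hBinf
  refine le_trans (csInf_le' ⟨range Φ, ?_, ?_, rfl⟩) hcard
  · rintro _ ⟨⟨Y, i, F⟩, rfl⟩
    refine ⟨(isOpen_biUnion fun n _ => hJo n).union (isOpen_biUnion fun n _ => hJo n), ?_⟩
    refine (measure_union_le _ _).trans_lt (ENNReal.add_lt_top.2 ⟨?_, ?_⟩)
    · exact aux_finite_union J hJf _ (hS1 Y i)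
    · exact measure_biUnion_lt_top F.finite_toSet fun n _ => (hJf n).lt_top
  · intro O _ hOf
    obtain ⟨A, hOA, hA⟩ := hJ O hOf
    have hAw : ∑' n : A, w n ≠ ∞ :=
      ne_top_of_le_ne_top hA (ENNReal.tsum_le_tsum fun n => min_le_right _ _)
    let H : Set I := {x | ∀ m, ∃ n ∈ A, m ≤ n ∧ x ∈ V n}
    have hH : volume H = 0 := by
      refine measure_mono_null ?_ (measure_limsup_cofinite_eq_zero (hVs A hAw))
      intro x hx
      rw [mem_limsup_iff_frequently_mem, frequently_cofinite_iff_infinite]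
      intro hfin
      obtain ⟨M, hM⟩ := (hfin.image Subtype.val).bddAbove
      obtain ⟨n, hnA, hMn, hxn⟩ := hx (M + 1)
      have := hM ⟨⟨n, hnA⟩, hxn, rfl⟩
      simp only at this
      omega
    obtain ⟨Y, hY, hHY⟩ := hcof (Subtype.val '' H) ((hval H).trans hH)
    obtain ⟨i, hi⟩ := hS2 ⟨Y, hY⟩ A fun x hx => hHY ⟨x, hx, rfl⟩
    refine ⟨_, ⟨(⟨Y, hY⟩, i, hi.toFinset), rfl⟩, fun x hx => ?_⟩
    have := hOA hx
    simp only [mem_iUnion] at this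
    obtain ⟨n, hnA, hxn⟩ := this
    by_cases hn : n ∈ S ⟨Y, hY⟩ i
    · exact Or.inl (mem_biUnion hn hxn)
    · refine Or.inr (mem_biUnion (show n ∈ hi.toFinset from ?_) hxn)
      exact hi.mem_toFinset.2 ⟨hnA, hn⟩

/-- The cofinality of the null ideal equals the cofinality of the poset of open sets of
finite measure ordered by inclusion. -/
theorem nullCof_eq_finiteMeasureOpenCof : nullCof = finiteMeasureOpenCof := by
  exact le_antisymm aux_le aux_ge

end
end

section
/- Let M be a transitive model of ZFC and let f ∈ ω^ω be an increasing function that is not eventually dominated by any function in M ∩ ω^ω. Then for every dense set D ⊆ ℂ with D ∈ M, where ℂ = ω^{<ω} is Cohen forcing ordered by reverse extension, the set D ∩ ℂ(f) is dense in ℂ(f). -/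
noncomputable section

open Filter

/-- Membership in the restricted Cohen forcing `ℂ(f)`: a finite sequence bounded by `f`
on its domain. -/
def cohenBelow (f : ℕ → ℕ) (σ : List ℕ) : Prop :=
  ∀ i : ℕ, i < σ.length → σ.getD i 0 ≤ f i

namespace CRD

@[simp] lemma sat_mem {M : ZFSet} {n} (i j : Fin n) (v) : SatM M (.mem i j) v ↔ v i ∈ v j := by
  rw [SatM]
@[simp] lemma sat_eq {M : ZFSet} {n} (i j : Fin n) (v) : SatM M (.eq i j) v ↔ v i = v j := by
  rw [SatM]
@[simp] lemma sat_imp {M : ZFSet} {n} (φ ψ : Fml n) (v) :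
    SatM M (.imp φ ψ) v ↔ (SatM M φ v → SatM M ψ v) := by
  rw [SatM]
@[simp] lemma sat_neg {M : ZFSet} {n} (φ : Fml n) (v) :
    SatM M (.neg φ) v ↔ ¬ SatM M φ v := by
  rw [SatM]
@[simp] lemma sat_all {M : ZFSet} {n} (φ : Fml (n+1)) (v) :
    SatM M (.all φ) v ↔ ∀ x ∈ M, SatM M φ (Fin.cons x v) := by
  rw [SatM]
@[simp] lemma sat_and {M : ZFSet} {n} (φ ψ : Fml n) (v) :
    SatM M (.and φ ψ) v ↔ (SatM M φ v ∧ SatM M ψ v) := by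
  simp [Fml.and]
@[simp] lemma sat_or {M : ZFSet} {n} (φ ψ : Fml n) (v) :
    SatM M (.or φ ψ) v ↔ (SatM M φ v ∨ SatM M ψ v) := by
  simp [Fml.or]; tauto
@[simp] lemma sat_iff {M : ZFSet} {n} (φ ψ : Fml n) (v) :
    SatM M (.iff φ ψ) v ↔ (SatM M φ v ↔ SatM M ψ v) := by
  simp [Fml.iff]; tauto
@[simp] lemma sat_ex {M : ZFSet} {n} (φ : Fml (n+1)) (v) :
    SatM M (.ex φ) v ↔ ∃ x ∈ M, SatM M φ (Fin.cons x v) := by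
  simp [Fml.ex]

lemma sat_rename {M : ZFSet} {m : ℕ} (φ : Fml m) : ∀ {k : ℕ} (r : Fin m → Fin k) (v : Fin k → ZFSet),
    SatM M (φ.rename r) v ↔ SatM M φ (fun i => v (r i)) := by
  induction φ with
  | mem i j => intros; simp [Fml.rename]
  | eq i j => intros; simp [Fml.rename]
  | imp φ ψ h1 h2 => intros; simp [Fml.rename, h1, h2]
  | neg φ h => intros; simp [Fml.rename, h]
  | all φ h =>
    intro k r v
    simp only [Fml.rename, sat_all, h]
    refine forall_congr' fun x => forall_congr' fun _ => ?_
    have : (fun i => (Fin.cons x v : Fin (k+1) → ZFSet) (Fin.cases 0 (fun j => (r j).succ) i))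
        = (Fin.cons x fun i => v (r i)) := by
      funext i
      refine Fin.cases ?_ (fun j => ?_) i <;> simp
    rw [this]

/-- Separation in `M`. -/
lemma sep_mem {M : ZFSet} (hM : IsTransModelZFC M) {n : ℕ} (φ : Fml (n+1)) (A : ZFSet) (hA : A ∈ M)
    (p : Fin n → ZFSet) (hp : ∀ i, p i ∈ M) :
    ∃ B ∈ M, ∀ x, x ∈ B ↔ x ∈ A ∧ SatM M φ (Fin.cons x p) := by
  obtain ⟨ht, -, -, -, -, -, -, -, hs, -⟩ := hM
  have h := hs n φ (Fin.cons A p) (by intro i; refine Fin.cases ?_ (fun j => ?_) i <;> simp [hA, hp])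
  simp only [axSep, sat_ex, sat_all, sat_iff, sat_and, sat_rename, sat_mem] at h
  obtain ⟨B, hB, h⟩ := h
  have key : ∀ x, (fun i : Fin (n+1) => (Fin.cons x (Fin.cons B (Fin.cons A p)) : Fin (n+3) → ZFSet)
      (Fin.cases 0 (fun j => j.succ.succ.succ) i)) = Fin.cons x p := by
    intro x; funext i
    refine Fin.cases ?_ (fun j => ?_) i <;> simp
  refine ⟨B, hB, fun x => ?_⟩
  have h' : x ∈ M → (x ∈ B ↔ x ∈ A ∧ SatM M φ (Fin.cons x p)) := by
    intro hx
    have := h x hx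
    rw [key] at this
    exact this
  exact ⟨fun hx => (h' (ht.mem_trans hx hB)).1 hx, fun hx => (h' (ht.mem_trans hx.1 hA)).2 hx⟩

lemma pairset_mem {M : ZFSet} (hM : IsTransModelZFC M) {a b : ZFSet} (ha : a ∈ M) (hb : b ∈ M) :
    ({a, b} : ZFSet) ∈ M := by
  have h := hM.2.2.1 ![a, b] (by intro i; fin_cases i <;> simp [ha, hb])
  simp only [axPair, sat_ex, sat_and, sat_mem] at h
  obtain ⟨C, hC, h1, h2⟩ := h
  change a ∈ C at h1
  change b ∈ C at h2
  obtain ⟨B, hB, h⟩ := sep_mem hM (n := 2) (.or (.eq 0 1) (.eq 0 2)) C hC ![a, b]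
    (by intro i; fin_cases i <;> simp [ha, hb])
  have : B = {a, b} := by
    ext x
    rw [h]
    simp only [sat_or, sat_eq, ZFSet.mem_pair]
    change x ∈ C ∧ (x = a ∨ x = b) ↔ _
    constructor
    · exact fun h => h.2
    · rintro (rfl | rfl) <;> simp [h1, h2]
  exact this ▸ hB

lemma singleton_mem {M : ZFSet} (hM : IsTransModelZFC M) {a : ZFSet} (ha : a ∈ M) :
    ({a} : ZFSet) ∈ M := by
  have := pairset_mem hM ha ha
  have e : ({a, a} : ZFSet) = {a} := by ext; simp
  rwa [e] at this

lemma pair_mem {M : ZFSet} (hM : IsTransModelZFC M) {a b : ZFSet} (ha : a ∈ M) (hb : b ∈ M) :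
    ZFSet.pair a b ∈ M :=
  pairset_mem hM (singleton_mem hM ha) (pairset_mem hM ha hb)

lemma insert_mem {M : ZFSet} (hM : IsTransModelZFC M) {a b : ZFSet} (ha : a ∈ M) (hb : b ∈ M) :
    (insert a b : ZFSet) ∈ M := by
  have hc := pairset_mem hM (singleton_mem hM ha) hb
  have h := hM.2.2.2.1 ![{{a}, b}] (by intro i; fin_cases i; simpa using hc)
  simp only [axUnion, sat_ex, sat_all, sat_imp, sat_and, sat_mem] at h
  obtain ⟨C, hC, h⟩ := h
  change ∀ y ∈ M, ∀ x ∈ M, x ∈ y ∧ y ∈ ({{a}, b} : ZFSet) → x ∈ C at h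
  have h1 : a ∈ C := h {a} (singleton_mem hM ha) a ha (by simp)
  have h2 : ∀ x ∈ b, x ∈ C := fun x hx => h b hb x (hM.1.mem_trans hx hb) (by simp [hx])
  obtain ⟨B, hB, h⟩ := sep_mem hM (n := 2) (.or (.eq 0 1) (.mem 0 2)) C hC ![a, b]
    (by intro i; fin_cases i <;> simp [ha, hb])
  have : B = insert a b := by
    ext x
    rw [h]
    simp only [sat_or, sat_eq, sat_mem, ZFSet.mem_insert_iff]
    change x ∈ C ∧ (x = a ∨ x ∈ b) ↔ _
    constructor
    · exact fun h => h.2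
    · rintro (rfl | h)
      · simp [h1]
      · simp [h2 x h, h]
  exact this ▸ hB

lemma power_mem {M : ZFSet} (hM : IsTransModelZFC M) {a : ZFSet} (ha : a ∈ M) :
    ∃ P ∈ M, ∀ x ∈ M, x ⊆ a → x ∈ P := by
  have h := hM.2.2.2.2.1 ![a] (by intro i; fin_cases i; simpa using ha)
  simp only [axPower, sat_ex, sat_all, sat_imp, sat_mem] at h
  obtain ⟨C, hC, h⟩ := h
  change ∀ y ∈ M, (∀ x ∈ M, x ∈ y → x ∈ a) → y ∈ C at h
  exact ⟨C, hC, fun x hx hs => h x hx fun y _ hy => hs hy⟩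

lemma inf_mem {M : ZFSet} (hM : IsTransModelZFC M) :
    ∃ I ∈ M, ∀ n, natZF n ∈ I := by
  have h := hM.2.2.2.2.2.1 ![] (by intro i; exact i.elim0)
  simp only [axInf, sat_ex, sat_all, sat_imp, sat_mem, sat_and, sat_neg, sat_iff, sat_or, sat_eq] at h
  obtain ⟨I, hI, ⟨e, he, heI, hemp⟩, hs⟩ := h
  change e ∈ I at heI
  change ∀ x ∈ M, ¬ x ∈ e at hemp
  change ∀ x ∈ M, x ∈ I → ∃ y ∈ M, y ∈ I ∧ x ∈ y ∧ ∀ z ∈ M, (z ∈ y ↔ z ∈ x ∨ z = x) at hs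
  refine ⟨I, hI, fun n => ?_⟩
  induction n with
  | zero =>
    have : e = ∅ := by
      rw [ZFSet.eq_empty]
      exact fun y hy => hemp y (hM.1.mem_trans hy he) hy
    simpa [natZF, this] using heI
  | succ n ih =>
    obtain ⟨y, hy, hyI, -, h⟩ := hs _ (hM.1.mem_trans ih hI) ih
    have : y = natZF (n+1) := by
      ext z
      simp only [natZF, ZFSet.mem_insert_iff]
      constructor
      · intro hz
        exact ((h z (hM.1.mem_trans hz hy)).1 hz).symm
      · intro hz
        refine (h z ?_).2 hz.symm
        rcases hz with rfl | hz
        · exact hM.1.mem_trans ih hI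
        · exact hM.1.mem_trans hz (hM.1.mem_trans ih hI)
    exact this ▸ hyI

lemma mem_natZF {n : ℕ} {x : ZFSet} : x ∈ natZF n ↔ ∃ i < n, x = natZF i := by
  induction n with
  | zero => simp [natZF]
  | succ n ih =>
    simp only [natZF, ZFSet.mem_insert_iff, ih]
    constructor
    · rintro (rfl | ⟨i, hi, rfl⟩)
      · exact ⟨n, by omega, rfl⟩
      · exact ⟨i, by omega, rfl⟩
    · rintro ⟨i, hi, rfl⟩
      rcases Nat.lt_succ_iff_lt_or_eq.1 hi with h | rfl
      · exact Or.inr ⟨i, h, rfl⟩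
      · exact Or.inl rfl

lemma natZF_inj {m n : ℕ} : natZF m = natZF n ↔ m = n := by
  refine ⟨fun h => ?_, fun h => h ▸ rfl⟩
  have aux : ∀ {a b : ℕ}, a < b → natZF a ≠ natZF b := by
    intro a b hab he
    have : natZF a ∈ natZF b := mem_natZF.2 ⟨a, hab, rfl⟩
    rw [he] at this
    exact ZFSet.mem_irrefl _ this
  rcases lt_trichotomy m n with h' | h' | h'
  · exact (aux h' h).elim
  · exact h'
  · exact (aux h' h.symm).elim

lemma natZF_mem {m n : ℕ} : natZF m ∈ natZF n ↔ m < n := by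
  rw [mem_natZF]
  constructor
  · rintro ⟨i, hi, h⟩
    rw [natZF_inj] at h; omega
  · exact fun h => ⟨m, h, rfl⟩

lemma mem_listZF {l : List ℕ} {q : ZFSet} :
    q ∈ listZF l ↔ ∃ i c : ℕ, l[i]? = some c ∧ q = ZFSet.pair (natZF i) (natZF c) := by
  simp only [listZF, ZFSet.mem_range]
  constructor
  · rintro ⟨i, rfl⟩
    exact ⟨i, l.get i, by simp, rfl⟩
  · rintro ⟨i, c, h, rfl⟩
    obtain ⟨hi, rfl⟩ := List.getElem?_eq_some_iff.1 h
    exact ⟨⟨i, hi⟩, rfl⟩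

lemma pair_mem_listZF {l : List ℕ} {i c : ℕ} :
    ZFSet.pair (natZF i) (natZF c) ∈ listZF l ↔ l[i]? = some c := by
  rw [mem_listZF]
  constructor
  · rintro ⟨i', c', h, he⟩
    rw [ZFSet.pair_inj, natZF_inj, natZF_inj] at he
    rw [he.1, he.2, h]
  · exact fun h => ⟨i, c, h, rfl⟩

lemma listZF_mem {M : ZFSet} (hM : IsTransModelZFC M) (l : List ℕ) : listZF l ∈ M := by
  obtain ⟨I, hI, hn⟩ := inf_mem hM
  have hnM : ∀ n, natZF n ∈ M := fun n => hM.1.mem_trans (hn n) hI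
  induction l using List.reverseRecOn with
  | nil =>
    have : listZF [] = natZF 0 := by
      ext x; simp [mem_listZF, natZF]
    rw [this]; exact hnM 0
  | append_singleton l a ih =>
    have : listZF (l ++ [a]) = insert (ZFSet.pair (natZF l.length) (natZF a)) (listZF l) := by
      ext x
      simp only [mem_listZF, ZFSet.mem_insert_iff]
      constructor
      · rintro ⟨i, c, h, rfl⟩
        rcases lt_trichotomy i l.length with h' | h' | h'
        · right
          rw [List.getElem?_append_left h'] at h
          exact ⟨i, c, h, rfl⟩
        · left
          subst h'
          simp at h
          rw [h]
        · rw [List.getElem?_eq_none (by simp; omega)] at h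
          simp at h
      · rintro (rfl | ⟨i, c, h, rfl⟩)
        · exact ⟨l.length, a, by simp, rfl⟩
        · refine ⟨i, c, ?_, rfl⟩
          obtain ⟨hi, -⟩ := List.getElem?_eq_some_iff.1 h
          rw [List.getElem?_append_left hi, h]
    rw [this]
    exact insert_mem hM (pair_mem hM (hnM _) (hnM _)) ih

/-- `v i = {v j, v k}` -/
def fUp {n} (i j k : Fin n) : Fml n :=
  .all (.iff (.mem 0 i.succ) (.or (.eq 0 j.succ) (.eq 0 k.succ)))

lemma sat_fUp {M : ZFSet} (hM : IsTransModelZFC M) {n} (i j k : Fin n) (v : Fin n → ZFSet)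
    (hi : v i ∈ M) (hj : v j ∈ M) (hk : v k ∈ M) :
    SatM M (fUp i j k) v ↔ v i = {v j, v k} := by
  simp only [fUp, sat_all, sat_iff, sat_or, sat_eq, sat_mem, Fin.cons_zero, Fin.cons_succ]
  constructor
  · intro h
    ext x
    rw [ZFSet.mem_pair]
    constructor
    · exact fun hx => (h x (hM.1.mem_trans hx hi)).1 hx
    · intro hx
      refine (h x ?_).2 hx
      rcases hx with rfl | rfl <;> assumption
  · intro h x _
    rw [h, ZFSet.mem_pair]

/-- `v i = (v j, v k)` -/
def fPair {n} (i j k : Fin n) : Fml n :=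
  .ex (.ex (.and (fUp 1 j.succ.succ j.succ.succ) (.and (fUp 0 j.succ.succ k.succ.succ)
    (fUp i.succ.succ 1 0))))

lemma sat_fPair {M : ZFSet} (hM : IsTransModelZFC M) {n} (i j k : Fin n) (v : Fin n → ZFSet)
    (hi : v i ∈ M) (hj : v j ∈ M) (hk : v k ∈ M) :
    SatM M (fPair i j k) v ↔ v i = ZFSet.pair (v j) (v k) := by
  simp only [fPair, sat_ex, sat_and]
  have e : ({v j, v j} : ZFSet) = {v j} := by ext; simp
  constructor
  · rintro ⟨a, ha, b, hb, h1, h2, h3⟩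
    rw [sat_fUp hM _ _ _ _ (by exact ha) (by exact hj) (by exact hj)] at h1
    rw [sat_fUp hM _ _ _ _ (by exact hb) (by exact hj) (by exact hk)] at h2
    rw [sat_fUp hM _ _ _ _ (by exact hi) (by exact ha) (by exact hb)] at h3
    change a = {v j, v j} at h1
    change b = {v j, v k} at h2
    change v i = {a, b} at h3
    rw [h3, h1, h2, e]; rfl
  · intro h
    have h1 := singleton_mem hM hj
    have h2 := pairset_mem hM hj hk
    refine ⟨{v j}, h1, {v j, v k}, h2, ?_, ?_, ?_⟩
    · rw [sat_fUp hM _ _ _ _ (by exact h1) (by exact hj) (by exact hj)]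
      exact e.symm
    · rw [sat_fUp hM _ _ _ _ (by exact h2) (by exact hj) (by exact hk)]
      rfl
    · rw [sat_fUp hM _ _ _ _ (by exact hi) (by exact h1) (by exact h2)]
      exact h

/-- the bounding formula; variables: `n b D σ z K` -/
def fPsi {m} (n b D s z K : Fin m) : Fml m :=
  .ex (.and (.mem 0 D.succ) (.and
    (.all (.imp (.mem 0 s.succ.succ) (.mem 0 1))) (.and
    (.all (.imp (.mem 0 n.succ.succ) (.or (.mem 0 K.succ.succ)
      (.ex (.and (fPair 0 1 z.succ.succ.succ) (.mem 0 2))))))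
    (.all (.imp (.mem 0 1) (.all (.all (.imp (fPair 2 1 0) (.mem 0 b.succ.succ.succ.succ)))))))))

/-- The combinatorial bounding relation. -/
def Q (D : Set (List ℕ)) (σ : List ℕ) (n b : ℕ) : Prop :=
  ∃ τ ∈ D, (∀ i c : ℕ, σ[i]? = some c → τ[i]? = some c) ∧
    (∀ i < n, i < σ.length ∨ τ[i]? = some 0) ∧ ∀ i c : ℕ, τ[i]? = some c → c < b

lemma mem_listSetZF {D : Set (List ℕ)} {x : ZFSet} : x ∈ listSetZF D ↔ ∃ τ ∈ D, x = listZF τ := by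
  simp only [listSetZF, ZFSet.mem_range]
  constructor
  · rintro ⟨⟨τ, h⟩, rfl⟩
    exact ⟨τ, h, rfl⟩
  · rintro ⟨τ, h, rfl⟩
    exact ⟨⟨τ, h⟩, rfl⟩

lemma natZF_memM {M : ZFSet} (hM : IsTransModelZFC M) (n : ℕ) : natZF n ∈ M := by
  obtain ⟨I, hI, hn⟩ := inf_mem hM
  exact hM.1.mem_trans (hn n) hI

lemma sat_fPsi {M : ZFSet} (hM : IsTransModelZFC M) {m} (n b D s z K : Fin m) (v : Fin m → ZFSet)
    (n' b' : ℕ) (D' : Set (List ℕ)) (σ : List ℕ)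
    (hn : v n = natZF n') (hb : v b = natZF b') (hD : v D = listSetZF D') (hs : v s = listZF σ)
    (hz : v z = natZF 0) (hK : v K = natZF σ.length) :
    SatM M (fPsi n b D s z K) v ↔ Q D' σ n' b' := by
  have hN := natZF_memM hM
  have hzM : v z ∈ M := by rw [hz]; exact hN 0
  have hL := listZF_mem hM
  simp only [fPsi, sat_ex, sat_and, sat_all, sat_imp, sat_or, sat_mem, Fin.cons_zero, Fin.cons_succ]
  constructor
  · rintro ⟨t, ht, h0, h1, h2, h3⟩
    rw [hD, mem_listSetZF] at h0
    obtain ⟨τ, hτ, rfl⟩ := h0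
    refine ⟨τ, hτ, ?_, ?_, ?_⟩
    · intro i c hic
      rw [← pair_mem_listZF] at hic ⊢
      exact h1 _ (pair_mem hM (hN _) (hN _)) (hs ▸ hic)
    · intro i hi
      rcases h2 (natZF i) (hN i) (by rw [hn]; exact natZF_mem.2 hi) with h | ⟨q, hq, h, hqt⟩
      · left; rw [hK] at h; exact natZF_mem.1 h
      · right
        rw [sat_fPair hM _ _ _ _ (by exact hq) (by exact hN i) (by exact hzM)] at h
        change q = ZFSet.pair (natZF i) (v z) at h
        change q ∈ listZF τ at hqt
        rw [h, hz, pair_mem_listZF] at hqt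
        exact hqt
    · intro i c hic
      rw [← pair_mem_listZF] at hic
      have := h3 _ (pair_mem hM (hN _) (hN _)) hic (natZF i) (hN i) (natZF c) (hN c)
        ((sat_fPair hM _ _ _ _ (by exact (pair_mem hM (hN _) (hN _))) (by exact hN i)
          (by exact hN c)).2 rfl)
      rw [hb] at this
      exact natZF_mem.1 this
  · rintro ⟨τ, hτ, h1, h2, h3⟩
    refine ⟨listZF τ, hL τ, by rw [hD, mem_listSetZF]; exact ⟨τ, hτ, rfl⟩, ?_, ?_, ?_⟩
    · intro q _ hq
      rw [hs, mem_listZF] at hq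
      obtain ⟨i, c, h, rfl⟩ := hq
      exact pair_mem_listZF.2 (h1 i c h)
    · intro x hx hxn
      rw [hn, mem_natZF] at hxn
      obtain ⟨i, hi, rfl⟩ := hxn
      rcases h2 i hi with h | h
      · left; rw [hK]; exact natZF_mem.2 h
      · right
        have hp := pair_mem hM (hN i) (hN 0)
        refine ⟨_, hp, (sat_fPair hM _ _ _ _ (by exact hp) (by exact hN i)
          (by exact hzM)).2 ?_, pair_mem_listZF.2 h⟩
        change _ = ZFSet.pair (natZF i) (v z)
        rw [hz]; rfl
    · intro q hq hqt i' hi c' hc h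
      rw [sat_fPair hM _ _ _ _ (by exact hq) (by exact hi) (by exact hc)] at h
      change q = ZFSet.pair i' c' at h
      change q ∈ listZF τ at hqt
      rw [mem_listZF] at hqt
      obtain ⟨i, c, hic, rfl⟩ := hqt
      rw [ZFSet.pair_inj] at h
      rw [← h.2, hb]
      exact natZF_mem.2 (h3 i c hic)

/-- `v x` occurs in the domain of an element of `v D` -/
def fNat {m} (x D : Fin m) : Fml m :=
  .ex (.and (.mem 0 D.succ) (.ex (.ex (.and (fPair 0 x.succ.succ.succ 1) (.mem 0 2)))))

lemma sat_fNat {M : ZFSet} (hM : IsTransModelZFC M) {m} (x D : Fin m) (v : Fin m → ZFSet)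
    (D' : Set (List ℕ)) (hx : v x ∈ M) (hD : v D = listSetZF D')
    (hdense : ∀ σ : List ℕ, ∃ τ ∈ D', σ <+: τ) :
    SatM M (fNat x D) v ↔ ∃ n, v x = natZF n := by
  have hN := natZF_memM hM
  have hL := listZF_mem hM
  simp only [fNat, sat_ex, sat_and, sat_mem, Fin.cons_zero, Fin.cons_succ]
  constructor
  · rintro ⟨t, ht, h0, c, hc, q, hq, h, hqt⟩
    rw [hD, mem_listSetZF] at h0
    obtain ⟨τ, hτ, rfl⟩ := h0
    rw [sat_fPair hM _ _ _ _ (by exact hq) (by exact hx) (by exact hc)] at h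
    change q = ZFSet.pair (v x) c at h
    change q ∈ listZF τ at hqt
    rw [mem_listZF] at hqt
    obtain ⟨i, c, hic, rfl⟩ := hqt
    rw [ZFSet.pair_inj] at h
    exact ⟨i, h.1.symm⟩
  · rintro ⟨n, h⟩
    obtain ⟨τ, hτ, hp⟩ := hdense (List.replicate (n+1) 0)
    have hl : n < τ.length := by have := hp.length_le; simp at this; omega
    have hp := pair_mem hM (hN n) (hN τ[n])
    refine ⟨listZF τ, hL τ, by rw [hD, mem_listSetZF]; exact ⟨τ, hτ, rfl⟩, natZF τ[n], hN _, _, hp,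
      (sat_fPair hM _ _ _ _ (by exact hp) (by exact hx) (by exact hN _)).2 ?_,
      pair_mem_listZF.2 (by simp)⟩
    change _ = ZFSet.pair (v x) (natZF τ[n])
    rw [h]; rfl

/-- The formula defining the bounding function; variables `p D σ z K`. -/
def fG : Fml 5 :=
  .ex (.ex (.and (fNat 1 3) (.and (fNat 0 3) (.and (fPair 2 1 0) (.and (fPsi 1 0 3 4 5 6)
    (.all (.imp (.mem 0 1) (.neg (fPsi 2 0 4 5 6 7)))))))))

lemma exists_Q {D : Set (List ℕ)} (hdense : ∀ σ : List ℕ, ∃ τ ∈ D, σ <+: τ) (σ : List ℕ) (n : ℕ) :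
    ∃ b, Q D σ n b := by
  obtain ⟨τ, hτ, hp⟩ := hdense (σ ++ List.replicate n 0)
  refine ⟨τ.sum + 1, τ, hτ, ?_, ?_, ?_⟩
  · intro i c h
    obtain ⟨t, rfl⟩ := hp
    obtain ⟨hi, -⟩ := List.getElem?_eq_some_iff.1 h
    rw [List.append_assoc, List.getElem?_append_left hi, h]
  · intro i hi
    by_cases h : i < σ.length
    · exact Or.inl h
    · right
      obtain ⟨t, rfl⟩ := hp
      rw [List.getElem?_append_left (by simp; omega), List.getElem?_append_right (by omega)]
      rw [List.getElem?_replicate, if_pos (by omega)]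
  · intro i c h
    have := List.le_sum_of_mem (List.mem_of_getElem? h)
    omega

open Classical in
lemma fun_mem {M : ZFSet} (hM : IsTransModelZFC M) {D : Set (List ℕ)} (hDM : listSetZF D ∈ M)
    (hdense : ∀ σ : List ℕ, ∃ τ ∈ D, σ <+: τ) (σ : List ℕ) :
    funZF (fun n => Nat.find (exists_Q hdense σ n)) ∈ M := by
  have hN := natZF_memM hM
  have hL := listZF_mem hM
  obtain ⟨I, hI, hnI⟩ := inf_mem hM
  obtain ⟨P, hP, hP'⟩ := power_mem hM hI
  obtain ⟨A, hA, hA'⟩ := power_mem hM hP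
  have hpA : ∀ a b : ℕ, ZFSet.pair (natZF a) (natZF b) ∈ A := by
    intro a b
    refine hA' _ (pair_mem hM (hN a) (hN b)) ?_
    intro x hx
    rw [ZFSet.pair, ZFSet.mem_pair] at hx
    rcases hx with rfl | rfl
    · refine hP' _ (singleton_mem hM (hN a)) ?_
      intro y hy
      rw [ZFSet.mem_singleton] at hy
      exact hy ▸ hnI a
    · refine hP' _ (pairset_mem hM (hN a) (hN b)) ?_
      intro y hy
      rw [ZFSet.mem_pair] at hy
      rcases hy with rfl | rfl <;> apply hnI
  obtain ⟨G, hG, h⟩ := sep_mem hM fG A hA ![listSetZF D, listZF σ, natZF 0, natZF σ.length]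
    (by intro i; fin_cases i <;> simp [hDM, hN, hL])
  suffices G = funZF (fun n => Nat.find (exists_Q hdense σ n)) from this ▸ hG
  ext p
  rw [h]
  simp only [fG, sat_ex, sat_and, sat_all, sat_imp, sat_neg, funZF, ZFSet.mem_range]
  constructor
  · rintro ⟨hpA, n, hn, b, hb, h1, h2, h3, h4, h5⟩
    rw [sat_fNat hM _ _ _ D (by exact hn) rfl hdense] at h1
    rw [sat_fNat hM _ _ _ D (by exact hb) rfl hdense] at h2
    obtain ⟨n, h1⟩ := h1
    obtain ⟨b, h2⟩ := h2
    cases h1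
    cases h2
    rw [sat_fPair hM _ _ _ _ (by exact hM.1.mem_trans hpA hA) (by exact hn) (by exact hb)] at h3
    rw [sat_fPsi hM _ _ _ _ _ _ _ n b D σ rfl rfl rfl rfl rfl rfl] at h4
    refine ⟨n, ?_⟩
    have : Nat.find (exists_Q hdense σ n) = b := by
      rw [Nat.find_eq_iff]
      refine ⟨h4, fun c hc hq => h5 (natZF c) (hN c) (natZF_mem.2 hc) ?_⟩
      exact (sat_fPsi hM _ _ _ _ _ _ _ n c D σ rfl rfl rfl rfl rfl rfl).2 hq
    rw [this]
    exact h3.symm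
  · rintro ⟨n, rfl⟩
    refine ⟨hpA _ _, natZF n, hN n, natZF (Nat.find (exists_Q hdense σ n)), hN _, ?_, ?_, ?_, ?_, ?_⟩
    · exact (sat_fNat hM _ _ _ D (by exact hN _) rfl hdense).2 ⟨n, rfl⟩
    · exact (sat_fNat hM _ _ _ D (by exact hN _) rfl hdense).2 ⟨_, rfl⟩
    · exact (sat_fPair hM _ _ _ _ (by exact pair_mem hM (hN _) (hN _)) (by exact hN _)
        (by exact hN _)).2 rfl
    · exact (sat_fPsi hM _ _ _ _ _ _ _ n _ D σ rfl rfl rfl rfl rfl rfl).2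
        (Nat.find_spec (exists_Q hdense σ n))
    · intro x hx hxb hq
      change x ∈ natZF _ at hxb
      rw [mem_natZF] at hxb
      obtain ⟨c, hc, rfl⟩ := hxb
      exact Nat.find_min _ hc
        ((sat_fPsi hM _ _ _ _ _ _ _ n c D σ rfl rfl rfl rfl rfl rfl).1 hq)

end CRD

/-- Let `M` be a transitive model of ZFC and `f ∈ ω^ω` an increasing function not
eventually dominated by any function in `M ∩ ω^ω`. Then for every dense `D ⊆ ℂ` with
`D ∈ M` (Cohen forcing `ℂ = ω^{<ω}`, ordered by reverse extension), the set `D ∩ ℂ(f)` is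
dense in `ℂ(f)`. -/
theorem cohen_restricted_density (M : ZFSet) (hM : IsTransModelZFC M)
    (f : ℕ → ℕ) (hf : Monotone f)
    (hunb : ∀ g : ℕ → ℕ, funZF g ∈ M → ∃ᶠ n in atTop, g n < f n)
    (D : Set (List ℕ)) (hDinM : listSetZF D ∈ M)
    (hDdense : ∀ σ : List ℕ, ∃ τ ∈ D, σ <+: τ) :
    ∀ σ : List ℕ, cohenBelow f σ → ∃ τ ∈ D, σ <+: τ ∧ cohenBelow f τ := by
  classical
  intro σ hσ
  have hfr := hunb _ (CRD.fun_mem hM hDinM hDdense σ)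
  obtain ⟨n, hn⟩ := hfr.exists
  obtain ⟨τ, hτ, h1, h2, h3⟩ := Nat.find_spec (CRD.exists_Q hDdense σ n)
  refine ⟨τ, hτ, ?_, ?_⟩
  · rw [List.prefix_iff_getElem?]
    intro i hi
    exact h1 i _ (by simp)
  · intro i hi
    have hget : τ[i]? = some (τ.getD i 0) := by simp [hi]
    by_cases hik : i < σ.length
    · have h := h1 i (σ.getD i 0) (by simp [hik])
      have := hσ i hik
      rw [hget] at h
      simp only [Option.some.injEq] at h
      rw [h]; exact this
    · by_cases hin : i < n
      · rcases h2 i hin with h | h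
        · exact absurd h hik
        · rw [hget] at h
          simp only [Option.some.injEq] at h
          rw [h]; exact Nat.zero_le _
      · have := h3 i _ hget
        have h' := hf (not_lt.1 hin)
        omega

end
end
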